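/- arXiv:1709.03936 — 2 statements merged into one kernel-verified Lean document; each statement's English description precedes it below -/
import Mathlib

section
/- For d ≥ 2 and n ≥ d+2, the good locus of L_{d,n} is path-connected. -/
/-- A (complex embedded affine) algebraic variety: the common zero set of a
finite collection of polynomials. -/
def IsVariety {ι : Type*} (V : Set (ι → ℂ)) : Prop :=
  ∃ S : Finset (MvPolynomial ι ℂ), V = {x | ∀ f ∈ S, MvPolynomial.eval x f = 0}

/-- A variety defined over ℚ: cut out by polynomials with rational coefficients. -/
def IsQVariety {ι : Type*} (V : Set (ι → ℂ)) : Prop :=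
  ∃ S : Finset (MvPolynomial ι ℚ), V = {x | ∀ f ∈ S, MvPolynomial.aeval x f = 0}

/-- An irreducible variety: a nonempty variety that is not a union of two proper
subvarieties. -/
def IsIrrVariety {ι : Type*} (V : Set (ι → ℂ)) : Prop :=
  IsVariety V ∧ V.Nonempty ∧
    ∀ V₁ V₂ : Set (ι → ℂ), IsVariety V₁ → IsVariety V₂ → V = V₁ ∪ V₂ → (V = V₁ ∨ V = V₂)

/-- A generic point of a variety `V`: a point of `V` whose coordinates satisfy no
polynomial equation with rational coefficients except those satisfied by every
point of `V`. -/
def IsGenericPt {ι : Type*} (V : Set (ι → ℂ)) (x : ι → ℂ) : Prop :=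
  x ∈ V ∧ ∀ f : MvPolynomial ι ℚ, MvPolynomial.aeval x f = 0 →
    ∀ y ∈ V, MvPolynomial.aeval y f = 0
/-- Edges of the complete graph `K_n`: unordered pairs of distinct vertices.
There are `N = C(n,2)` of them, and they index the coordinates of `ℂ^N`. -/
abbrev Edge (n : ℕ) : Type := {e : Sym2 (Fin n) // ¬ e.IsDiag}

/-- Complex squared length along an edge: `m_ij(p) = Σ_k (p_i^k − p_j^k)²`
(complex squares, no conjugation). -/
noncomputable def cSqLen {n d : ℕ} (p : Fin n → Fin d → ℂ) : Sym2 (Fin n) → ℂ :=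
  Sym2.lift ⟨fun i j => ∑ k, (p i k - p j k) ^ 2,
    fun i j => Finset.sum_congr rfl fun k _ => by ring⟩

/-- The squared measurement variety `M_{d,n}`: the image of the squared
measurement map over all complex configurations of `n` points in ℂ^d. -/
def Mvar (d n : ℕ) : Set (Edge n → ℂ) :=
  {w | ∃ p : Fin n → Fin d → ℂ, ∀ e : Edge n, w e = cSqLen p e.val}

/-- The coordinate-wise squaring map `s`. -/
def sqMap {n : ℕ} (w : Edge n → ℂ) : Edge n → ℂ := fun e => w e ^ 2

/-- The unsquared measurement variety `L_{d,n} = s⁻¹(M_{d,n})`. -/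
def Lvar (d n : ℕ) : Set (Edge n → ℂ) := sqMap ⁻¹' Mvar d n
/-- Dimension of a variety `V`, as the supremum of lengths of chains of
irreducible subvarieties of `V` (Krull dimension of the poset of irreducible
subvarieties contained in `V`). -/
noncomputable def varDim {ι : Type*} (V : Set (ι → ℂ)) : WithBot ℕ∞ :=
  Order.krullDim {W : Set (ι → ℂ) // IsIrrVariety W ∧ W ⊆ V}

/-- Local dimension of `V` at a point `x`: the dimension of the
highest-dimensional irreducible component of `V` containing `x` (Krull dimension
of the poset of irreducible subvarieties of `V` containing `x`). -/
noncomputable def localDim {ι : Type*} (V : Set (ι → ℂ)) (x : ι → ℂ) : WithBot ℕ∞ :=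
  Order.krullDim {W : Set (ι → ℂ) // IsIrrVariety W ∧ W ⊆ V ∧ x ∈ W}

/-- The Zariski tangent space of `V` at `x`: the kernel of the Jacobian, at `x`,
of the ideal of all polynomials vanishing on `V`. -/
noncomputable def zTangent {ι : Type*} [Fintype ι] (V : Set (ι → ℂ)) (x : ι → ℂ) :
    Submodule ℂ (ι → ℂ) where
  carrier := {v | ∀ f : MvPolynomial ι ℂ, (∀ y ∈ V, MvPolynomial.eval y f = 0) →
      ∑ i, v i * MvPolynomial.eval x (MvPolynomial.pderiv i f) = 0}
  add_mem' := by
    intro a b ha hb f hf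
    have h1 := ha f hf
    have h2 := hb f hf
    simp only [Pi.add_apply, add_mul]
    rw [Finset.sum_add_distrib, h1, h2, add_zero]
  zero_mem' := by
    intro f hf
    simp
  smul_mem' := by
    intro c a ha f hf
    have h1 := ha f hf
    simp only [Pi.smul_apply, smul_eq_mul, mul_assoc]
    rw [← Finset.mul_sum, h1, mul_zero]

/-- An (algebraically) singular point of `V`: a point of `V` where the dimension
of the Zariski tangent space differs from the local dimension. -/
def IsSingularPt {ι : Type*} [Fintype ι] (V : Set (ι → ℂ)) (x : ι → ℂ) : Prop :=
  x ∈ V ∧ (Module.finrank ℂ (zTangent V x) : WithBot ℕ∞) ≠ localDim V x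

/-- The good locus of `M_{d,n}`: the complement in `M_{d,n}` of the bad locus,
which is the union of the singular locus with the set of points having at least
one vanishing coordinate. -/
def goodM (d n : ℕ) : Set (Edge n → ℂ) :=
  {w | w ∈ Mvar d n ∧ ¬ IsSingularPt (Mvar d n) w ∧ ∀ e : Edge n, w e ≠ 0}

/-- The good locus of `L_{d,n}`: the preimage under the squaring map of the good
locus of `M_{d,n}`. -/
def goodL (d n : ℕ) : Set (Edge n → ℂ) := sqMap ⁻¹' goodM d n

open MvPolynomial in
theorem irr_prime {ι : Type*} {W : Set (ι → ℂ)} (hW : IsIrrVariety W)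
    (f g : MvPolynomial ι ℂ) (h : ∀ w ∈ W, eval w f * eval w g = 0) :
    (∀ w ∈ W, eval w f = 0) ∨ (∀ w ∈ W, eval w g = 0) := by
  classical
  obtain ⟨⟨S, hS⟩, hne, hirr⟩ := hW
  have key : ∀ f : MvPolynomial ι ℂ, IsVariety (W ∩ {x | eval x f = 0}) := by
    intro f
    refine ⟨insert f S, ?_⟩
    ext x
    rw [hS]
    simp [and_comm]
  rcases hirr _ _ (key f) (key g) (by
    ext x
    constructor
    · intro hx
      rcases mul_eq_zero.1 (h x hx) with h1 | h1
      · exact Or.inl ⟨hx, h1⟩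
      · exact Or.inr ⟨hx, h1⟩
    · rintro (hx | hx) <;> exact hx.1) with h1 | h1
  · left
    intro w hw
    rw [h1] at hw
    exact hw.2
  · right
    intro w hw
    rw [h1] at hw
    exact hw.2

/-- Zariski closure -/
def zcl {ι : Type*} (S : Set (ι → ℂ)) : Set (ι → ℂ) :=
  {w | ∀ f : MvPolynomial ι ℂ, (∀ y ∈ S, MvPolynomial.eval y f = 0) → MvPolynomial.eval w f = 0}

theorem subset_zcl {ι : Type*} (S : Set (ι → ℂ)) : S ⊆ zcl S := fun _ hw _ hf => hf _ hw

theorem zcl_mono {ι : Type*} {S T : Set (ι → ℂ)} (h : S ⊆ T) : zcl S ⊆ zcl T :=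
  fun _ hw f hf => hw f fun y hy => hf y (h hy)

open MvPolynomial in
theorem zcl_isVariety {ι : Type*} [Finite ι] (S : Set (ι → ℂ)) : IsVariety (zcl S) := by
  let I : Ideal (MvPolynomial ι ℂ) :=
    { carrier := {f | ∀ y ∈ S, eval y f = 0}
      add_mem' := by
        intro a b ha hb y hy
        simp [ha y hy, hb y hy]
      zero_mem' := by
        intro y hy
        simp
      smul_mem' := by
        intro c a ha y hy
        simp [ha y hy] }
  obtain ⟨T, hT⟩ := (isNoetherianRing_iff_ideal_fg _).1 inferInstance I
  refine ⟨T, ?_⟩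
  ext x
  constructor
  · intro hx f hf
    apply hx
    have : f ∈ I := by rw [← hT]; exact Ideal.subset_span hf
    exact this
  · intro hx f hf
    have hfI : f ∈ I := hf
    rw [← hT] at hfI
    have hle : Ideal.span (T : Set (MvPolynomial ι ℂ)) ≤ RingHom.ker (eval x) := by
      rw [Ideal.span_le]
      intro g hg
      exact hx g hg
    exact hle hfI

open MvPolynomial in
theorem zcl_irr {ι : Type*} [Finite ι] (S : Set (ι → ℂ)) (hne : S.Nonempty)
    (hp : ∀ f g : MvPolynomial ι ℂ, (∀ w ∈ S, eval w f * eval w g = 0) →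
      (∀ w ∈ S, eval w f = 0) ∨ (∀ w ∈ S, eval w g = 0)) : IsIrrVariety (zcl S) := by
  refine ⟨zcl_isVariety S, hne.mono (subset_zcl S), ?_⟩
  rintro V₁ V₂ ⟨S₁, h₁⟩ ⟨S₂, h₂⟩ hU
  by_contra hcon
  push Not at hcon
  have aux : ∀ (V' : Set (ι → ℂ)) (S' : Finset (MvPolynomial ι ℂ)),
      V' = {x | ∀ f ∈ S', eval x f = 0} → V' ⊆ zcl S → zcl S ≠ V' →
      ∃ f ∈ S', ¬ ∀ w ∈ S, eval w f = 0 := by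
    intro V' S' hV' hsub hne
    by_contra hc
    push Not at hc
    apply hne
    apply Set.Subset.antisymm _ hsub
    intro w hw
    rw [hV']
    intro f hf
    exact hw f (hc f hf)
  obtain ⟨f, hf, hf'⟩ := aux V₁ S₁ h₁ (by rw [hU]; exact Set.subset_union_left) hcon.1
  obtain ⟨g, hg, hg'⟩ := aux V₂ S₂ h₂ (by rw [hU]; exact Set.subset_union_right) hcon.2
  rcases hp f g (by
    intro w hw
    have := subset_zcl S hw
    rw [hU] at this
    rcases this with h | h
    · rw [h₁] at h
      rw [h f hf, zero_mul]
    · rw [h₂] at h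
      rw [h g hg, mul_zero]) with h | h
  · exact hf' h
  · exact hg' h

open MvPolynomial in
theorem clear_denom {ι J : Type*} (δ : MvPolynomial J ℂ) (g : ι → MvPolynomial J ℂ)
    (f : MvPolynomial ι ℂ) : ∃ (N : ℕ) (F : MvPolynomial J ℂ), ∀ y, eval y δ ≠ 0 →
      eval y F = eval y δ ^ N * eval (fun e => eval y (g e) / eval y δ) f := by
  induction f using MvPolynomial.induction_on with
  | C a => exact ⟨0, C a, fun y _ => by simp⟩
  | add p q hp hq =>
    obtain ⟨N, F, h⟩ := hp
    obtain ⟨N', F', h'⟩ := hq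
    refine ⟨N + N', δ ^ N' * F + δ ^ N * F', fun y hy => ?_⟩
    simp only [map_add, map_mul, map_pow, h y hy, h' y hy]
    ring
  | mul_X p e hp =>
    obtain ⟨N, F, h⟩ := hp
    refine ⟨N + 1, F * g e, fun y hy => ?_⟩
    simp only [map_mul, h y hy, eval_X]
    field_simp
    ring

/-- restriction of a polynomial to a line -/
theorem exists_line {J : Type*} (f : MvPolynomial J ℂ) (a u : J → ℂ) :
    ∃ P : Polynomial ℂ, ∀ t : ℂ, P.eval t = MvPolynomial.eval (a + t • u) f := by
  refine ⟨MvPolynomial.aeval (fun j => Polynomial.C (a j) + Polynomial.X * Polynomial.C (u j)) f,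
    fun t => ?_⟩
  induction f using MvPolynomial.induction_on with
  | C a => simp
  | add p q hp hq => rw [map_add, Polynomial.eval_add, hp, hq, map_add]
  | mul_X p e hp =>
    rw [map_mul, Polynomial.eval_mul, hp, map_mul]
    simp [mul_comm t]

theorem common_nonzero {J : Type*} (s : Finset (MvPolynomial J ℂ)) (a b : J → ℂ)
    (h : ∀ f ∈ s, MvPolynomial.eval a f ≠ 0 ∨ MvPolynomial.eval b f ≠ 0) :
    ∃ t : ℂ, ∀ f ∈ s, MvPolynomial.eval (a + t • (b - a)) f ≠ 0 := by
  choose P hP using fun f : MvPolynomial J ℂ => exists_line f a (b - a)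
  have hne : ∏ f ∈ s, P f ≠ 0 := by
    rw [Finset.prod_ne_zero_iff]
    intro f hf h0
    rcases h f hf with h1 | h1
    · apply h1
      have := hP f 0
      simpa [h0] using this.symm
    · apply h1
      have := hP f 1
      simpa [h0] using this.symm
  obtain ⟨t, ht⟩ := Polynomial.exists_eval_ne_zero_of_natDegree_lt_card (R := ℂ) (∏ f ∈ s, P f) hne
    (lt_of_lt_of_le (Cardinal.natCast_lt_aleph0) (Cardinal.aleph0_le_mk ℂ))
  refine ⟨t, fun f hf => ?_⟩
  rw [Polynomial.eval_prod, Finset.prod_ne_zero_iff] at ht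
  rw [← hP]
  exact ht f hf

open MvPolynomial in
theorem hasDerivAt_mv {ι : Type*} [Fintype ι] (f : MvPolynomial ι ℂ) (c : ι → ℂ → ℂ) (c' : ι → ℂ)
    (t : ℂ) (h : ∀ e, HasDerivAt (c e) (c' e) t) :
    HasDerivAt (fun s => eval (fun e => c e s) f)
      (∑ e, c' e * eval (fun e => c e t) (pderiv e f)) t := by
  classical
  induction f using MvPolynomial.induction_on with
  | C a => simpa using hasDerivAt_const t a
  | add p q hp hq =>
    have h1 := hp.fun_add hq
    have e1 : (fun s => eval (fun e => c e s) (p + q)) =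
        fun s => eval (fun e => c e s) p + eval (fun e => c e s) q := by
      funext s; simp
    rw [e1]
    refine h1.congr_deriv ?_
    simp [mul_add, Finset.sum_add_distrib]
  | mul_X p e hp =>
    have h1 := hp.fun_mul (h e)
    have e1 : (fun s => eval (fun e => c e s) (p * X e)) =
        fun s => eval (fun e => c e s) p * c e s := by
      funext s; simp
    rw [e1]
    refine h1.congr_deriv ?_
    simp only [Derivation.leibniz, pderiv_X, smul_eq_mul, map_add, map_mul, eval_X, mul_add,
        Finset.sum_add_distrib]
    rw [add_comm, Finset.sum_mul]
    congr 1
    · rw [Finset.sum_eq_single e]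
      · simp
        ring
      · intro b _ hb
        simp [hb.symm]
      · simp
    · apply Finset.sum_congr rfl
      intros; ring


section chart
open MvPolynomial

/-- pullback along a linear map -/
noncomputable def linPull {ι J : Type*} [Fintype ι] [DecidableEq ι]
    (π : (ι → ℂ) →ₗ[ℂ] (J → ℂ)) : MvPolynomial J ℂ →ₐ[ℂ] MvPolynomial ι ℂ :=
  aeval fun j => ∑ e, C (π (Pi.single e 1) j) * X e

theorem eval_linPull {ι J : Type*} [Fintype ι] [DecidableEq ι]
    (π : (ι → ℂ) →ₗ[ℂ] (J → ℂ)) (f : MvPolynomial J ℂ) (w : ι → ℂ) :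
    eval w (linPull π f) = eval (π w) f := by
  have hw : ∀ j, ∑ e, π (Pi.single e 1) j * w e = π w j := by
    intro j
    conv_rhs => rw [← Finset.univ_sum_single w]
    rw [map_sum, Finset.sum_apply]
    apply Finset.sum_congr rfl
    intro e _
    have : (Pi.single e (w e) : ι → ℂ) = w e • Pi.single e 1 := by
      rw [← Pi.single_smul]; simp
    rw [this, map_smul]
    simp [mul_comm]
  induction f using MvPolynomial.induction_on with
  | C a => simp [linPull]
  | add p q hp hq => rw [map_add, map_add, hp, hq, map_add]
  | mul_X p e hp =>
    rw [map_mul, map_mul, hp, map_mul]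
    congr 1
    simp [linPull, hw]

variable {ι J : Type*} [Fintype ι] [Fintype J] (V : Set (ι → ℂ)) (hV : zcl V ⊆ V)
    (π : (ι → ℂ) →ₗ[ℂ] (J → ℂ)) (δ : MvPolynomial J ℂ) (g : ι → MvPolynomial J ℂ)
    (h1 : ∀ w ∈ V, ∀ e, eval (π w) δ * w e = eval (π w) (g e))
    (h2 : ∀ y, eval y δ ≠ 0 → (fun e => eval y (g e) / eval y δ) ∈ V ∧
      π (fun e => eval y (g e) / eval y δ) = y)
    (x : ι → ℂ) (hx : x ∈ V) (hδ : eval (π x) δ ≠ 0)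

include h1 in
theorem chart_eq (w : ι → ℂ) (hw : w ∈ V) (hd : eval (π w) δ ≠ 0) :
    (fun e => eval (π w) (g e) / eval (π w) δ) = w := by
  funext e
  rw [← h1 w hw e]
  field_simp

include h1 in
theorem chart_clear (f : MvPolynomial ι ℂ) : ∃ (N : ℕ) (F : MvPolynomial J ℂ), ∀ w ∈ V,
      eval (π w) F = eval (π w) δ ^ N * eval w f := by
  obtain ⟨N, F, h⟩ := clear_denom δ g f
  refine ⟨N + 1, δ * F, fun w hw => ?_⟩
  by_cases hd : eval (π w) δ = 0
  · simp [hd]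
  · rw [map_mul, h _ hd, chart_eq V π δ g h1 w hw hd]
    ring

/-- The ideal of a subvariety pulled back to the chart. -/
def chartIdeal (W : Set (ι → ℂ)) (hW : IsIrrVariety W) : PrimeSpectrum (MvPolynomial J ℂ) where
  asIdeal :=
    { carrier := {f | ∀ w ∈ W, eval (π w) f = 0}
      add_mem' := by
        intro a b ha hb y hy
        simp [ha y hy, hb y hy]
      zero_mem' := by
        intro y hy
        simp
      smul_mem' := by
        intro c a ha y hy
        simp [ha y hy] }
  isPrime := by
    classical
    constructor
    · intro h
      obtain ⟨w, hw⟩ := hW.2.1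
      rw [Ideal.eq_top_iff_one] at h
      have := h w hw
      simp at this
    · intro a b hab
      have := irr_prime hW (linPull π a) (linPull π b) (by
        intro w hw
        rw [eval_linPull, eval_linPull, ← map_mul]
        exact hab w hw)
      simp only [eval_linPull] at this
      exact this

include h1 hδ in
theorem chart_dim_le : localDim V x ≤ (Fintype.card J : ℕ) := by
  classical
  have hk : Order.krullDim (PrimeSpectrum (MvPolynomial J ℂ))ᵒᵈ = (Fintype.card J : ℕ) := by
    rw [Order.krullDim_orderDual]
    have := MvPolynomial.ringKrullDim_of_isNoetherianRing (R := ℂ) (ι := J)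
    rw [ringKrullDim_eq_zero_of_field] at this
    simpa [ringKrullDim] using this
  rw [← hk]
  refine Order.krullDim_le_of_strictMono
    (fun W => OrderDual.toDual (chartIdeal π W.1 W.2.1)) ?_
  rintro ⟨W₁, hW₁, hV₁, hx₁⟩ ⟨W₂, hW₂, hV₂, hx₂⟩ hlt
  have hlt' : W₁ ⊂ W₂ := hlt
  rw [OrderDual.toDual_lt_toDual]
  refine lt_of_le_not_ge (fun f hf w hw => hf w (hlt'.1 hw)) ?_
  intro hle
  apply hlt'.2
  obtain ⟨S, hS⟩ := hW₁.1
  intro w hw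
  rw [hS]
  intro f hf
  obtain ⟨N, F, hF⟩ := chart_clear V π δ g h1 f
  have hF1 : F ∈ (chartIdeal π W₁ hW₁).asIdeal := by
    intro w hw
    rw [hF w (hV₁ hw)]
    rw [hS] at hw
    rw [hw f hf, mul_zero]
  have hF2 : ∀ w ∈ W₂, eval (π w) F = 0 := fun w hw => hle hF1 w hw
  rcases irr_prime hW₂ (linPull π δ ^ N) f (by
    intro w hw
    rw [map_pow, eval_linPull, ← hF w (hV₂ hw)]
    exact hF2 w hw) with h | h
  · exfalso
    have := h x hx₂
    rw [map_pow, eval_linPull] at this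
    exact pow_ne_zero N hδ this
  · exact h w hw

include hV h1 h2 hx hδ in
theorem chart_le_dim : (Fintype.card J : ℕ) ≤ localDim V x := by
  classical
  let o := Fintype.equivFin J
  let S : Fin (Fintype.card J + 1) → Set (ι → ℂ) := fun i =>
    {w | w ∈ V ∧ eval (π w) δ ≠ 0 ∧ ∀ j, (i : ℕ) ≤ (o j : ℕ) → π w j = π x j}
  have hxS : ∀ i, x ∈ S i := fun i => ⟨hx, hδ, fun _ _ => rfl⟩
  have hirr : ∀ i, IsIrrVariety (zcl (S i)) := by
    intro i
    apply zcl_irr _ ⟨x, hxS i⟩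
    intro f f' hff
    by_contra hcon
    push Not at hcon
    obtain ⟨⟨a, ha, hfa⟩, ⟨b, hb, hfb⟩⟩ := hcon
    obtain ⟨N, F, hF⟩ := chart_clear V π δ g h1 f
    obtain ⟨N', F', hF'⟩ := chart_clear V π δ g h1 f'
    obtain ⟨t, ht⟩ := common_nonzero {F, F', δ} (π a) (π b) (by
      intro q hq
      simp only [Finset.mem_insert, Finset.mem_singleton] at hq
      rcases hq with rfl | rfl | rfl
      · left
        rw [hF a ha.1]
        exact mul_ne_zero (pow_ne_zero _ ha.2.1) hfa
      · right
        rw [hF' b hb.1]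
        exact mul_ne_zero (pow_ne_zero _ hb.2.1) hfb
      · left
        exact ha.2.1)
    set y := π a + t • (π b - π a) with hy
    have hdy := ht δ (by simp)
    obtain ⟨hc, hcy⟩ := h2 y hdy
    set c : ι → ℂ := fun e => eval y (g e) / eval y δ with hcdef
    have hcS : c ∈ S i := by
      refine ⟨hc, by rw [hcy]; exact hdy, ?_⟩
      intro j hj
      rw [hcy, hy]
      simp [ha.2.2 j hj, hb.2.2 j hj]
    have h3 := ht F (by simp)
    have h4 := ht F' (by simp)
    rw [← hcy, hF c hc] at h3
    rw [← hcy, hF' c hc] at h4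
    have := hff c hcS
    rcases mul_eq_zero.1 this with h | h
    · simp [h] at h3
    · simp [h] at h4
  let L : LTSeries {W : Set (ι → ℂ) // IsIrrVariety W ∧ W ⊆ V ∧ x ∈ W} :=
    { length := Fintype.card J
      toFun := fun i => ⟨zcl (S i), hirr i,
        (zcl_mono (fun w hw => hw.1)).trans hV, subset_zcl _ (hxS i)⟩
      step := by
        intro i
        show zcl (S i.castSucc) ⊂ zcl (S i.succ)
        refine ⟨zcl_mono ?_, ?_⟩
        · intro w hw
          refine ⟨hw.1, hw.2.1, fun j hj => hw.2.2 j ?_⟩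
          simp only [Fin.val_succ] at hj
          simp only [Fin.val_castSucc]
          omega
        · intro hsub
          let j := o.symm i
          have hj : (o j : ℕ) = i := by simp [j]
          have hv : ∀ w ∈ zcl (S i.castSucc), π w j = π x j := by
            intro w hw
            have := hw (linPull π (X j - C (π x j))) (by
              intro y hy
              rw [eval_linPull]
              simp only [map_sub, eval_X, eval_C]
              rw [hy.2.2 j (by simp [hj]), sub_self])
            rw [eval_linPull] at this
            simpa [sub_eq_zero] using this
          obtain ⟨t, ht⟩ := common_nonzero {X j - C (π x j), δ} (π x) (π x + Pi.single j 1) (by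
            intro q hq
            simp only [Finset.mem_insert, Finset.mem_singleton] at hq
            rcases hq with rfl | rfl
            · right
              simp
            · left
              exact hδ)
          set y := π x + t • (π x + Pi.single j 1 - π x) with hy
          have hdy := ht δ (by simp)
          have hjy := ht (X j - C (π x j)) (by simp)
          obtain ⟨hc, hcy⟩ := h2 y hdy
          set c : ι → ℂ := fun e => eval y (g e) / eval y δ with hcdef
          have hcS : c ∈ S i.succ := by
            refine ⟨hc, by rw [hcy]; exact hdy, ?_⟩
            intro k hk
            rw [hcy, hy]
            have : k ≠ j := by
              rintro rfl
              simp only [Fin.val_succ] at hk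
              omega
            simp [this]
          have := hv c (hsub (subset_zcl _ hcS))
          rw [hcy] at this
          simp [this] at hjy }
  exact Order.LTSeries.length_le_krullDim L

include h1 h2 hx hδ in
theorem chart_tangent : Module.finrank ℂ (zTangent V x) = Fintype.card J := by
  classical
  have hdir : ∀ (f : MvPolynomial ι ℂ) (u : ι → ℂ), HasDerivAt (fun s : ℂ => eval (x + s • u) f)
      (∑ e, u e * eval x (pderiv e f)) 0 := by
    intro f u
    have := hasDerivAt_mv f (fun e s => x e + s * u e) u 0 (by
      intro e
      simpa using ((hasDerivAt_id (0:ℂ)).mul_const (u e)).const_add (x e))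
    have e0 : (fun e => x e + 0 * u e) = x := by funext e; simp
    rw [e0] at this
    exact this
  let φ : zTangent V x →ₗ[ℂ] (J → ℂ) := π.comp (zTangent V x).subtype
  have hinj : Function.Injective φ := by
    rw [← LinearMap.ker_eq_bot, LinearMap.ker_eq_bot']
    rintro ⟨v, hv⟩ hφ
    have hπ : π v = 0 := hφ
    ext e
    show v e = 0
    have hv' : ∑ i, v i * eval x (pderiv i (linPull π δ * X e - linPull π (g e))) = 0 := by
      apply hv
      intro y hy
      rw [map_sub, map_mul, eval_linPull, eval_linPull, eval_X, h1 y hy, sub_self]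
    have hd := hdir (linPull π δ * X e - linPull π (g e)) v
    rw [hv'] at hd
    have hfun : (fun s : ℂ => eval (x + s • v) (linPull π δ * X e - linPull π (g e))) =
        fun s : ℂ => eval (π x) δ * (x e + s * v e) - eval (π x) (g e) := by
      funext s
      rw [map_sub, map_mul, eval_linPull, eval_linPull, eval_X, map_add, map_smul, hπ]
      simp
    rw [hfun] at hd
    have hd2 : HasDerivAt (fun s : ℂ => eval (π x) δ * (x e + s * v e) - eval (π x) (g e))
        (eval (π x) δ * v e) 0 := by
      simpa using ((((hasDerivAt_id (0:ℂ)).mul_const (v e)).const_add (x e)).const_mul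
        (eval (π x) δ)).sub_const (eval (π x) (g e))
    have := hd.unique hd2
    exact (mul_eq_zero.1 this.symm).resolve_left hδ
  have hsurj : Function.Surjective φ := by
    intro u
    have hline : ∀ q : MvPolynomial J ℂ, DifferentiableAt ℂ
        (fun s : ℂ => eval (π x + s • u) q) 0 := by
      intro q
      obtain ⟨P, hP⟩ := exists_line q (π x) u
      have : (fun s : ℂ => eval (π x + s • u) q) = fun s => P.eval s := by
        funext s; rw [hP]
      rw [this]
      exact P.differentiable.differentiableAt
    have h0 : eval (π x + (0:ℂ) • u) δ ≠ 0 := by simpa using hδ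
    let c : ι → ℂ → ℂ := fun e s => eval (π x + s • u) (g e) / eval (π x + s • u) δ
    have hc : ∀ e, HasDerivAt (c e) (deriv (c e) 0) 0 := fun e =>
      ((hline (g e)).fun_div (hline δ) h0).hasDerivAt
    have hc0 : (fun e => c e 0) = x := by
      have := chart_eq V π δ g h1 x hx hδ
      simpa [c] using this
    have hev : ∀ᶠ s : ℂ in nhds 0, eval (π x + s • u) δ ≠ 0 :=
      (hline δ).continuousAt.eventually_ne h0
    refine ⟨⟨fun e => deriv (c e) 0, ?_⟩, ?_⟩
    · intro f hf
      have hd := hasDerivAt_mv f c _ 0 hc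
      rw [hc0] at hd
      have hz : (fun s => eval (fun e => c e s) f) =ᶠ[nhds 0] fun _ => 0 := by
        filter_upwards [hev] with s hs
        exact hf _ (h2 _ hs).1
      exact hd.unique ((hasDerivAt_const (0:ℂ) (0:ℂ)).congr_of_eventuallyEq hz)
    · funext j
      show π (fun e => deriv (c e) 0) j = u j
      have hd := hasDerivAt_mv (linPull π (X j)) c _ 0 hc
      have hz : (fun s => eval (fun e => c e s) (linPull π (X j))) =ᶠ[nhds 0]
          fun s => π x j + s * u j := by
        filter_upwards [hev] with s hs
        rw [eval_linPull, (h2 _ hs).2]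
        simp
      have hd2 : HasDerivAt (fun s : ℂ => π x j + s * u j) (u j) 0 := by
        simpa using ((hasDerivAt_id (0:ℂ)).mul_const (u j)).const_add (π x j)
      have hu := hd.unique (hd2.congr_of_eventuallyEq hz)
      rw [← hu]
      have hd3 := hdir (linPull π (X j)) (fun e => deriv (c e) 0)
      rw [hc0]
      have hd4 : HasDerivAt (fun s : ℂ => π x j + s * π (fun e => deriv (c e) 0) j)
          (π (fun e => deriv (c e) 0) j) 0 := by
        simpa using ((hasDerivAt_id (0:ℂ)).mul_const
          (π (fun e => deriv (c e) 0) j)).const_add (π x j)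
      refine HasDerivAt.unique hd4 ?_
      refine hd3.congr_of_eventuallyEq (Filter.Eventually.of_forall fun s => ?_)
      show _ = eval _ _
      rw [eval_linPull, map_add, map_smul]
      simp
  rw [(LinearEquiv.ofBijective φ ⟨hinj, hsurj⟩).finrank_eq]
  simp

include hV h1 h2 hx hδ in
theorem chart_nonsing : ¬ IsSingularPt V x := by
  rintro ⟨-, h⟩
  apply h
  rw [chart_tangent V π δ g h1 h2 x hx hδ]
  exact le_antisymm (chart_le_dim V hV π δ g h1 h2 x hx hδ) (chart_dim_le V π δ g h1 x hδ)

end chart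


section linalg
open Matrix

theorem exists_li_rows {m n : Type*} [Fintype m] [Fintype n] (M : Matrix m n ℂ) (k : ℕ)
    (h : k ≤ M.rank) : ∃ r : Fin k → m, LinearIndependent ℂ (M.submatrix r id).row := by
  rw [M.rank_eq_finrank_span_row] at h
  obtain ⟨f, hf, -, hli⟩ := Submodule.exists_fun_fin_finrank_span_eq ℂ (Set.range M.row)
  choose r hr using hf
  refine ⟨fun i => r (Fin.castLE h i), ?_⟩
  have : (M.submatrix (fun i => r (Fin.castLE h i)) id).row = f ∘ Fin.castLE h := by
    funext i
    rw [Function.comp, ← hr]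
    rfl
  rw [this]
  exact hli.comp _ (Fin.castLE_injective h)

theorem rank_le_of_minors {m : Type*} [Fintype m] (G : Matrix m m ℂ) (d : ℕ)
    (h : ∀ r c : Fin (d + 1) → m, (G.submatrix r c).det = 0) : G.rank ≤ d := by
  by_contra hcon
  push Not at hcon
  obtain ⟨r, hr⟩ := exists_li_rows G (d + 1) hcon
  have hrk := hr.rank_matrix
  rw [← Matrix.rank_transpose] at hrk
  obtain ⟨c, hc⟩ := exists_li_rows (G.submatrix r id)ᵀ (d + 1) (by rw [hrk]; simp)
  have hu := Matrix.linearIndependent_rows_iff_isUnit.1 hc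
  rw [Matrix.isUnit_iff_isUnit_det] at hu
  apply hu.ne_zero
  rw [← Matrix.det_transpose]
  exact h r c

theorem symm_factor {m : Type*} [Fintype m] [DecidableEq m] (G : Matrix m m ℂ) (hG : Gᵀ = G)
    (d : ℕ) (hd : G.rank ≤ d) : ∃ P : Matrix m (Fin d) ℂ, G = P * Pᵀ := by
  classical
  have hsymm : LinearMap.IsSymm (Matrix.toBilin' G) := by
    constructor
    intro x y
    simp only [RingHom.id_apply, Matrix.toBilin'_apply']
    rw [Matrix.dotProduct_mulVec, ← Matrix.mulVec_transpose, hG, dotProduct_comm]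
  obtain ⟨v, hv⟩ := LinearMap.BilinForm.exists_orthogonal_basis hsymm
  let e : m ≃ Fin (Module.finrank ℂ (m → ℂ)) :=
    (Fintype.equivFin m).trans (finCongr (by simp))
  let v' := v.reindex e.symm
  let S : Matrix m m ℂ := (Pi.basisFun ℂ m).toMatrix v'
  have hSinv : IsUnit S := by
    have := (Pi.basisFun ℂ m).invertibleToMatrix v'
    exact isUnit_of_invertible S
  have hSdet : IsUnit S.det := (Matrix.isUnit_iff_isUnit_det S).1 hSinv
  let D : m → ℂ := fun i => (Sᵀ * G * S) i i
  have hD : Sᵀ * G * S = diagonal D := by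
    ext i j
    by_cases hij : i = j
    · subst hij; simp [D]
    · rw [diagonal_apply_ne _ hij]
      have h1 := hv (show e i ≠ e j from fun h => hij (e.injective h))
      have h2 : (Matrix.toBilin' G) (v' i) (v' j) = 0 := by
        simpa [v', Function.onFun] using h1
      rw [Matrix.toBilin'_apply'] at h2
      rw [← h2]
      simp only [Matrix.mul_apply, dotProduct, mulVec, S, Module.Basis.toMatrix_apply, transpose_apply,
        Pi.basisFun_repr, Finset.mul_sum, Finset.sum_mul]
      rw [Finset.sum_comm]
      apply Finset.sum_congr rfl
      intro a _
      apply Finset.sum_congr rfl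
      intro b _
      ring
  have hrank : Fintype.card {i // D i ≠ 0} ≤ d := by
    rw [← Matrix.rank_diagonal, ← hD]
    exact ((Matrix.rank_mul_le_left _ _).trans (Matrix.rank_mul_le_right _ _)).trans hd
  obtain ⟨σ⟩ : Nonempty ({i // D i ≠ 0} ↪ Fin d) :=
    Function.Embedding.nonempty_of_card_le (by simpa using hrank)
  choose q hq using fun i => IsAlgClosed.exists_pow_nat_eq (D i) (n := 2) (by norm_num)
  let E : Matrix m (Fin d) ℂ := of fun i k =>
    if h : D i ≠ 0 then (if σ ⟨i, h⟩ = k then q i else 0) else 0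
  have hE : E * Eᵀ = diagonal D := by
    ext i j
    rw [mul_apply]
    by_cases hi : D i ≠ 0
    · by_cases hij : i = j
      · subst hij
        simp [E, hi, ← sq, hq]
      · rw [diagonal_apply_ne _ hij]
        apply Finset.sum_eq_zero
        intro k _
        by_cases hj : D j ≠ 0
        · simp only [E, of_apply, dif_pos hi, dif_pos hj, transpose_apply]
          by_cases h1 : σ ⟨i, hi⟩ = k
          · by_cases h2 : σ ⟨j, hj⟩ = k
            · exfalso
              apply hij
              have := σ.injective (h1.trans h2.symm)
              simpa using this
            · simp [h2]
          · simp [h1]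
        · simp [E, hj]
    · push Not at hi
      rw [Finset.sum_eq_zero (by intro k _; simp [E, hi])]
      by_cases hij : i = j
      · subst hij; simp [hi]
      · rw [diagonal_apply_ne _ hij]
  refine ⟨(S⁻¹)ᵀ * E, ?_⟩
  have h1 : S⁻¹ᵀ * Sᵀ = 1 := by
    rw [← transpose_mul, Matrix.mul_nonsing_inv _ hSdet, transpose_one]
  calc G = (S⁻¹ᵀ * Sᵀ) * G * (S * S⁻¹) := by
        rw [h1, Matrix.mul_nonsing_inv _ hSdet]; simp
    _ = S⁻¹ᵀ * (Sᵀ * G * S) * S⁻¹ := by simp only [Matrix.mul_assoc]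
    _ = S⁻¹ᵀ * E * (S⁻¹ᵀ * E)ᵀ := by
        rw [hD, ← hE]
        simp only [transpose_mul, transpose_transpose, Matrix.mul_assoc]

end linalg

section polyfun

/-- polynomial functions -/
def IsPF {ι : Type*} (F : (ι → ℂ) → ℂ) : Prop :=
  ∃ f : MvPolynomial ι ℂ, ∀ w, MvPolynomial.eval w f = F w

theorem IsPF.const {ι : Type*} (c : ℂ) : IsPF (fun _ : ι → ℂ => c) :=
  ⟨MvPolynomial.C c, by simp⟩

theorem IsPF.coord {ι : Type*} (e : ι) : IsPF (fun w : ι → ℂ => w e) :=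
  ⟨MvPolynomial.X e, by simp⟩

theorem IsPF.add {ι : Type*} {F G : (ι → ℂ) → ℂ} (hF : IsPF F) (hG : IsPF G) :
    IsPF (fun w => F w + G w) := by
  obtain ⟨f, hf⟩ := hF
  obtain ⟨g, hg⟩ := hG
  exact ⟨f + g, by simp [hf, hg]⟩

theorem IsPF.mul {ι : Type*} {F G : (ι → ℂ) → ℂ} (hF : IsPF F) (hG : IsPF G) :
    IsPF (fun w => F w * G w) := by
  obtain ⟨f, hf⟩ := hF
  obtain ⟨g, hg⟩ := hG
  exact ⟨f * g, by simp [hf, hg]⟩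

theorem IsPF.sub {ι : Type*} {F G : (ι → ℂ) → ℂ} (hF : IsPF F) (hG : IsPF G) :
    IsPF (fun w => F w - G w) := by
  obtain ⟨f, hf⟩ := hF
  obtain ⟨g, hg⟩ := hG
  exact ⟨f - g, by simp [hf, hg]⟩

theorem IsPF.sum {ι κ : Type*} (s : Finset κ) {F : κ → (ι → ℂ) → ℂ} (hF : ∀ k ∈ s, IsPF (F k)) :
    IsPF (fun w => ∑ k ∈ s, F k w) := by
  classical
  induction s using Finset.induction_on with
  | empty => simpa using IsPF.const 0
  | insert a s ha ih =>
    simp only [Finset.sum_insert ha]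
    exact (hF a (by simp)).add (ih fun k hk => hF k (by simp [hk]))

theorem IsPF.prod {ι κ : Type*} (s : Finset κ) {F : κ → (ι → ℂ) → ℂ} (hF : ∀ k ∈ s, IsPF (F k)) :
    IsPF (fun w => ∏ k ∈ s, F k w) := by
  classical
  induction s using Finset.induction_on with
  | empty => simpa using IsPF.const 1
  | insert a s ha ih =>
    simp only [Finset.prod_insert ha]
    exact (hF a (by simp)).mul (ih fun k hk => hF k (by simp [hk]))

theorem IsPF.det {ι κ : Type*} [Fintype κ] [DecidableEq κ] {A : (ι → ℂ) → Matrix κ κ ℂ}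
    (hA : ∀ i j, IsPF (fun w => A w i j)) : IsPF (fun w => (A w).det) := by
  simp only [Matrix.det_apply']
  exact IsPF.sum _ fun σ _ => (IsPF.const _).mul (IsPF.prod _ fun i _ => hA _ _)

theorem IsPF.adjugate {ι κ : Type*} [Fintype κ] [DecidableEq κ] {A : (ι → ℂ) → Matrix κ κ ℂ}
    (hA : ∀ i j, IsPF (fun w => A w i j)) (i j : κ) : IsPF (fun w => (A w).adjugate i j) := by
  simp only [Matrix.adjugate_apply]
  refine IsPF.det fun k l => ?_
  simp only [Matrix.updateRow_apply]
  split_ifs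
  · exact IsPF.const _
  · exact hA _ _

theorem IsPF.matmul {ι κ μ ν : Type*} [Fintype κ] {A : (ι → ℂ) → Matrix μ κ ℂ}
    {B : (ι → ℂ) → Matrix κ ν ℂ} (hA : ∀ i j, IsPF (fun w => A w i j))
    (hB : ∀ i j, IsPF (fun w => B w i j)) (i : μ) (j : ν) : IsPF (fun w => (A w * B w) i j) := by
  simp only [Matrix.mul_apply]
  exact IsPF.sum _ fun k _ => (hA _ _).mul (hB _ _)

end polyfun


section gram
open Matrix

/-- extension of an edge function by zero on the diagonal -/
noncomputable def ew {n : ℕ} (w : Edge n → ℂ) (e : Sym2 (Fin n)) : ℂ :=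
  if h : e.IsDiag then 0 else w ⟨e, h⟩

/-- the non-root vertices -/
def vtx (d r : ℕ) (s : Fin d ⊕ Fin r) : Fin (d + r + 1) := (finSumFinEquiv s).succ

theorem vtx_cases {d r : ℕ} (v : Fin (d + r + 1)) : v = 0 ∨ ∃ s, v = vtx d r s := by
  refine Fin.cases (Or.inl rfl) (fun i => Or.inr ⟨finSumFinEquiv.symm i, ?_⟩) v
  simp [vtx]

/-- Gram matrix of an edge function -/
noncomputable def Gm (d r : ℕ) (w : Edge (d + r + 1) → ℂ) :
    Matrix (Fin d ⊕ Fin r) (Fin d ⊕ Fin r) ℂ :=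
  of fun s t => (ew w s(0, vtx d r s) + ew w s(0, vtx d r t) - ew w s(vtx d r s, vtx d r t)) / 2

theorem Gm_symm {d r : ℕ} (w : Edge (d + r + 1) → ℂ) (s t) : Gm d r w s t = Gm d r w t s := by
  simp only [Gm, of_apply]
  rw [Sym2.eq_swap (a := vtx d r s) (b := vtx d r t)]
  ring

theorem ew_add {n : ℕ} (w w' : Edge n → ℂ) (e) : ew (w + w') e = ew w e + ew w' e := by
  unfold ew; split_ifs <;> simp

theorem ew_smul {n : ℕ} (c : ℂ) (w : Edge n → ℂ) (e) : ew (c • w) e = c * ew w e := by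
  unfold ew; split_ifs <;> simp

theorem ew_diag {n : ℕ} (w : Edge n → ℂ) (v) : ew w s(v, v) = 0 := by
  unfold ew; rw [dif_pos (by simp)]

theorem ew_pf {n : ℕ} (e : Sym2 (Fin n)) : IsPF (fun w => ew w e) := by
  unfold ew; split_ifs
  · exact IsPF.const 0
  · exact IsPF.coord _

theorem Gm_pf {d r : ℕ} (s t) : IsPF (fun w => Gm d r w s t) := by
  simp only [Gm, of_apply, div_eq_mul_inv]
  exact (((ew_pf _).add (ew_pf _)).sub (ew_pf _)).mul (IsPF.const _)

theorem ew_root {d r : ℕ} (w : Edge (d + r + 1) → ℂ) (s) :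
    ew w s(0, vtx d r s) = Gm d r w s s := by
  simp only [Gm, of_apply, ew_diag]; ring

theorem ew_pair {d r : ℕ} (w : Edge (d + r + 1) → ℂ) (s t) :
    ew w s(vtx d r s, vtx d r t) = Gm d r w s s + Gm d r w t t - 2 * Gm d r w s t := by
  simp only [Gm, of_apply, ew_diag]; ring

theorem Gm_inj {d r : ℕ} (w w' : Edge (d + r + 1) → ℂ) (h : Gm d r w = Gm d r w') : w = w' := by
  have key : ∀ e, ew w e = ew w' e := by
    intro e
    induction e using Sym2.ind with
    | _ u v =>
    rcases vtx_cases u with rfl | ⟨s, rfl⟩ <;> rcases vtx_cases v with rfl | ⟨t, rfl⟩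
    · simp [ew_diag]
    · rw [ew_root, ew_root, h]
    · rw [Sym2.eq_swap, ew_root, ew_root, h]
    · rw [ew_pair, ew_pair, h]
  funext ⟨e, he⟩
  have := key e
  unfold ew at this
  rwa [dif_neg he, dif_neg he] at this

theorem ew_meas {n d : ℕ} (p : Fin n → Fin d → ℂ) (e) :
    ew (fun e : Edge n => cSqLen p e.val) e = cSqLen p e := by
  unfold ew
  split_ifs with h
  · induction e using Sym2.ind with
    | _ u v =>
    simp at h
    subst h
    simp [cSqLen]
  · rfl

/-- position matrix relative to the root -/
def posM {d r : ℕ} (p : Fin (d + r + 1) → Fin d → ℂ) : Matrix (Fin d ⊕ Fin r) (Fin d) ℂ :=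
  of fun s k => p (vtx d r s) k - p 0 k

theorem Gm_meas {d r : ℕ} (p : Fin (d + r + 1) → Fin d → ℂ) :
    Gm d r (fun e => cSqLen p e.val) = posM p * (posM p)ᵀ := by
  ext s t
  simp only [Gm, of_apply, ew_meas, mul_apply, posM, transpose_apply]
  simp only [cSqLen, Sym2.lift_mk]
  rw [← Finset.sum_add_distrib, ← Finset.sum_sub_distrib, Finset.sum_div]
  apply Finset.sum_congr rfl
  intro k _
  ring

theorem mem_M_iff {d r : ℕ} (w : Edge (d + r + 1) → ℂ) :
    w ∈ Mvar d (d + r + 1) ↔ (Gm d r w).rank ≤ d := by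
  constructor
  · rintro ⟨p, hp⟩
    have : w = fun e => cSqLen p e.val := funext hp
    rw [this, Gm_meas]
    refine (rank_mul_le_left _ _).trans ?_
    simpa using rank_le_card_width (posM p)
  · intro h
    obtain ⟨P, hP⟩ := symm_factor (Gm d r w) (by ext s t; exact Gm_symm w t s) d h
    let p : Fin (d + r + 1) → Fin d → ℂ :=
      Fin.cases 0 (fun i => P (finSumFinEquiv.symm i))
    have hp : posM p = P := by
      ext s k
      simp [posM, vtx, p]
    refine ⟨p, fun e => ?_⟩
    have : w = fun e => cSqLen p e.val := by
      apply Gm_inj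
      rw [Gm_meas, hp, hP]
    exact congrFun this e

theorem M_zcl {d r : ℕ} : zcl (Mvar d (d + r + 1)) ⊆ Mvar d (d + r + 1) := by
  intro w hw
  rw [mem_M_iff]
  apply rank_le_of_minors
  intro a b
  obtain ⟨f, hf⟩ : IsPF (fun w => ((Gm d r w).submatrix a b).det) :=
    IsPF.det fun i j => Gm_pf _ _
  beta_reduce at hf
  rw [← hf]
  apply hw
  intro y hy
  rw [hf]
  rw [mem_M_iff] at hy
  by_contra hne
  have h1 := rank_of_det_ne_zero hne
  have h2 := rank_submatrix_le (Gm d r y) a b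
  simp at h1
  omega

/-- chart coordinates -/
abbrev JJ (d r : ℕ) := Sym2 (Fin d) ⊕ (Fin d × Fin r)

noncomputable def chartPi (d r : ℕ) : (Edge (d + r + 1) → ℂ) →ₗ[ℂ] (JJ d r → ℂ) where
  toFun w := Sum.elim
    (Sym2.lift ⟨fun i j => Gm d r w (Sum.inl i) (Sum.inl j), fun _ _ => Gm_symm _ _ _⟩)
    (fun q => Gm d r w (Sum.inl q.1) (Sum.inr q.2))
  map_add' := by
    intro w w'
    funext j
    rcases j with e | q
    · induction e using Sym2.ind with
      | _ i j =>
      simp [Gm, ew_add]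
      ring
    · simp [Gm, ew_add]
      ring
  map_smul' := by
    intro c w
    funext j
    rcases j with e | q
    · induction e using Sym2.ind with
      | _ i j =>
      simp [Gm, ew_smul]
      ring
    · simp [Gm, ew_smul]
      ring

def cA {d r : ℕ} (y : JJ d r → ℂ) : Matrix (Fin d) (Fin d) ℂ := of fun i j => y (Sum.inl s(i, j))
def cB {d r : ℕ} (y : JJ d r → ℂ) : Matrix (Fin d) (Fin r) ℂ := of fun i k => y (Sum.inr (i, k))

theorem cA_symm {d r : ℕ} (y : JJ d r → ℂ) : (cA y)ᵀ = cA y := by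
  ext i j
  simp [cA, Sym2.eq_swap]

theorem cA_pi {d r : ℕ} (w) : cA (chartPi d r w) = (Gm d r w).toBlocks₁₁ := by
  ext i j; simp [cA, chartPi, toBlocks₁₁]

theorem cB_pi {d r : ℕ} (w) : cB (chartPi d r w) = (Gm d r w).toBlocks₁₂ := by
  ext i j; simp [cB, chartPi, toBlocks₁₂]

noncomputable def cH {d r : ℕ} (y : JJ d r → ℂ) : Matrix (Fin d ⊕ Fin r) (Fin d ⊕ Fin r) ℂ :=
  fromBlocks ((cA y).det • cA y) ((cA y).det • cB y) ((cA y).det • (cB y)ᵀ)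
    ((cB y)ᵀ * (cA y).adjugate * cB y)

theorem cH_symm {d r : ℕ} (y : JJ d r → ℂ) : (cH y)ᵀ = cH y := by
  unfold cH
  rw [fromBlocks_transpose]
  simp only [transpose_smul, cA_symm, transpose_mul, transpose_transpose, adjugate_transpose,
    Matrix.mul_assoc]

theorem cH_pf {d r : ℕ} (s t) : IsPF (fun y : JJ d r → ℂ => cH y s t) := by
  have hA : ∀ i j, IsPF (fun y : JJ d r → ℂ => cA y i j) := fun i j => IsPF.coord _
  have hB : ∀ i j, IsPF (fun y : JJ d r → ℂ => cB y i j) := fun i j => IsPF.coord _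
  have hB' : ∀ i j, IsPF (fun y : JJ d r → ℂ => (cB y)ᵀ i j) := fun i j => IsPF.coord _
  have hdet : IsPF (fun y : JJ d r → ℂ => (cA y).det) := IsPF.det hA
  rcases s with s | s <;> rcases t with t | t
  · exact hdet.mul (hA s t)
  · exact hdet.mul (hB s t)
  · exact hdet.mul (hB' s t)
  · exact IsPF.matmul (IsPF.matmul hB' (IsPF.adjugate hA)) hB s t

/-- extension by zero -/
def exH {d r : ℕ} (H : Matrix (Fin d ⊕ Fin r) (Fin d ⊕ Fin r) ℂ) (u v : Fin (d + r + 1)) : ℂ :=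
  Fin.cases 0 (fun i => Fin.cases 0
    (fun j => H (finSumFinEquiv.symm i) (finSumFinEquiv.symm j)) v) u

def recM {d r : ℕ} (H : Matrix (Fin d ⊕ Fin r) (Fin d ⊕ Fin r) ℂ) (e : Sym2 (Fin (d + r + 1))) : ℂ :=
  Sym2.lift ⟨fun u v => exH H u u + exH H v v - exH H u v - exH H v u, fun u v => by ring⟩ e

theorem exH_pf {d r : ℕ} (u v) : IsPF (fun y : JJ d r → ℂ => exH (cH y) u v) := by
  rcases vtx_cases u with rfl | ⟨s, rfl⟩ <;> rcases vtx_cases v with rfl | ⟨t, rfl⟩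
  · simpa [exH] using IsPF.const 0
  · simpa [exH] using IsPF.const 0
  · simpa [exH, vtx] using IsPF.const 0
  · simpa [exH, vtx] using cH_pf s t

theorem recM_pf {d r : ℕ} (e) : IsPF (fun y : JJ d r → ℂ => recM (cH y) e) := by
  induction e using Sym2.ind with
  | _ u v =>
  simp only [recM, Sym2.lift_mk]
  exact (((exH_pf _ _).add (exH_pf _ _)).sub (exH_pf _ _)).sub (exH_pf _ _)

theorem ew_recM {d r : ℕ} (H : Matrix (Fin d ⊕ Fin r) (Fin d ⊕ Fin r) ℂ) (e) :
    ew (fun e : Edge (d + r + 1) => recM H e.val) e = recM H e := by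
  unfold ew
  split_ifs with h
  · induction e using Sym2.ind with
    | _ u v =>
    simp at h
    subst h
    simp [recM]
  · rfl

theorem Gm_recM {d r : ℕ} (H : Matrix (Fin d ⊕ Fin r) (Fin d ⊕ Fin r) ℂ) (hH : Hᵀ = H) :
    Gm d r (fun e => recM H e.val) = H := by
  ext s t
  have : H t s = H s t := congrFun (congrFun hH s) t
  simp only [Gm, of_apply, ew_recM]
  simp [recM, exH, vtx, this]
  ring

theorem recM_smul {d r : ℕ} (c : ℂ) (H : Matrix (Fin d ⊕ Fin r) (Fin d ⊕ Fin r) ℂ) (e) :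
    recM (c • H) e = c * recM H e := by
  have hx : ∀ u v, exH (c • H) u v = c * exH H u v := by
    intro u v
    rcases vtx_cases u with rfl | ⟨s, rfl⟩ <;> rcases vtx_cases v with rfl | ⟨t, rfl⟩ <;>
      simp [exH, vtx]
  induction e using Sym2.ind with
  | _ u v =>
  simp only [recM, Sym2.lift_mk, hx]
  ring

theorem recM_Gm {d r : ℕ} (w : Edge (d + r + 1) → ℂ) :
    (fun e => recM (Gm d r w) e.val) = w := by
  apply Gm_inj
  rw [Gm_recM]
  ext s t
  exact Gm_symm w t s

theorem cH_pi {d r : ℕ} (w : Edge (d + r + 1) → ℂ) (hw : w ∈ Mvar d (d + r + 1)) :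
    cH (chartPi d r w) = (cA (chartPi d r w)).det • Gm d r w := by
  obtain ⟨p, hp⟩ := hw
  have hw' : w = fun e => cSqLen p e.val := funext hp
  set P := posM p with hP
  have hG : Gm d r w = P * Pᵀ := by rw [hw', Gm_meas]
  set P₁ := P.toRows₁ with hP₁
  set P₂ := P.toRows₂ with hP₂
  have hPP : P = fromRows P₁ P₂ := (fromRows_toRows P).symm
  have hG2 : Gm d r w = fromBlocks (P₁ * P₁ᵀ) (P₁ * P₂ᵀ) (P₂ * P₁ᵀ) (P₂ * P₂ᵀ) := by
    rw [hG, hPP, transpose_fromRows, fromRows_mul_fromCols]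
  unfold cH
  rw [cA_pi, cB_pi, hG2, toBlocks_fromBlocks₁₁, toBlocks_fromBlocks₁₂, fromBlocks_smul]
  congr 1
  · simp
  · rw [transpose_mul, transpose_transpose, adjugate_mul_distrib, det_mul, det_transpose]
    calc P₂ * P₁ᵀ * (P₁ᵀ.adjugate * P₁.adjugate) * (P₁ * P₂ᵀ)
        = P₂ * (P₁ᵀ * P₁ᵀ.adjugate) * (P₁.adjugate * P₁) * P₂ᵀ := by
          simp only [Matrix.mul_assoc]
      _ = (P₁.det * P₁.det) • (P₂ * P₂ᵀ) := by
          rw [mul_adjugate, adjugate_mul, det_transpose]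
          simp [smul_smul]

theorem cH_rank {d r : ℕ} (y : JJ d r → ℂ) (h : (cA y).det ≠ 0) :
    ((cA y).det⁻¹ • cH y).rank ≤ d := by
  have hA : (cA y).det⁻¹ • (cA y).adjugate = (cA y)⁻¹ := by
    rw [inv_def, Ring.inverse_eq_inv']
  have hu : IsUnit (cA y).det := IsUnit.mk0 _ h
  have : (cA y).det⁻¹ • cH y = fromRows 1 ((cB y)ᵀ * (cA y)⁻¹) * fromCols (cA y) (cB y) := by
    rw [fromRows_mul_fromCols]
    unfold cH
    rw [fromBlocks_smul]
    congr 1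
    · simp [smul_smul, h]
    · simp [smul_smul, h]
    · rw [Matrix.mul_assoc, nonsing_inv_mul _ hu]
      simp [smul_smul, h]
    · rw [← hA]
      simp
  rw [this]
  refine (rank_mul_le_left _ _).trans ?_
  simpa using rank_le_card_width (fromRows (1 : Matrix (Fin d) (Fin d) ℂ) ((cB y)ᵀ * (cA y)⁻¹))

theorem nonsing_of_det {d r : ℕ} (p : Fin (d + r + 1) → Fin d → ℂ)
    (h : (posM p).toRows₁.det ≠ 0) :
    ¬ IsSingularPt (Mvar d (d + r + 1)) (fun e => cSqLen p e.val) := by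
  obtain ⟨δ, hδ⟩ : IsPF (fun y : JJ d r → ℂ => (cA y).det) := IsPF.det fun i j => IsPF.coord _
  choose g hg using fun e : Edge (d + r + 1) => recM_pf (d := d) (r := r) e.val
  beta_reduce at hδ hg
  refine chart_nonsing _ M_zcl (chartPi d r) δ g ?_ ?_ _ ⟨p, fun e => rfl⟩ ?_
  · intro w hw e
    rw [hδ, hg, cH_pi w hw, recM_smul]
    congr 1
    exact (congrFun (recM_Gm w) e).symm
  · intro y hy
    rw [hδ] at hy
    have he : (fun e => MvPolynomial.eval y (g e) / MvPolynomial.eval y δ) =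
        fun e : Edge (d + r + 1) => recM ((cA y).det⁻¹ • cH y) e.val := by
      funext e
      rw [recM_smul, hδ, hg, div_eq_inv_mul]
    have hG : Gm d r (fun e : Edge (d + r + 1) => recM ((cA y).det⁻¹ • cH y) e.val) =
        (cA y).det⁻¹ • cH y := by
      apply Gm_recM
      rw [transpose_smul, cH_symm]
    rw [he]
    constructor
    · rw [mem_M_iff, hG]
      exact cH_rank y hy
    · funext j
      rcases j with e | q
      · induction e using Sym2.ind with
        | _ i j =>
        change Gm d r _ (Sum.inl i) (Sum.inl j) = _
        rw [hG]
        change (cA y).det⁻¹ * ((cA y).det * y _) = _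
        exact inv_mul_cancel_left₀ hy _
      · change Gm d r _ (Sum.inl q.1) (Sum.inr q.2) = _
        rw [hG]
        change (cA y).det⁻¹ * ((cA y).det * y _) = _
        exact inv_mul_cancel_left₀ hy _
  · rw [hδ, cA_pi, Gm_meas]
    have : (posM p * (posM p)ᵀ).toBlocks₁₁ = (posM p).toRows₁ * (posM p).toRows₁ᵀ := by
      ext i j; simp [toBlocks₁₁, mul_apply, toRows₁]
    rw [this, det_mul, det_transpose]
    exact mul_ne_zero h h

end gram

section conf
open Matrix

theorem common_pt {ι κ : Type*} [Fintype κ] (F : κ → (ι → ℂ) → ℂ) (hF : ∀ k, IsPF (F k))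
    (h : ∀ k, ∃ w, F k w ≠ 0) : ∃ w, ∀ k, F k w ≠ 0 := by
  choose f hf using hF
  have hne : ∏ k, f k ≠ 0 := by
    rw [Finset.prod_ne_zero_iff]
    intro k _ h0
    obtain ⟨w, hw⟩ := h k
    apply hw
    rw [← hf, h0, map_zero]
  by_contra hcon
  push Not at hcon
  apply hne
  apply MvPolynomial.funext
  intro w
  obtain ⟨k, hk⟩ := hcon w
  rw [map_prod, map_zero]
  exact Finset.prod_eq_zero (Finset.mem_univ k) (by rw [hf, hk])

theorem cSqLen_pf {ι : Type*} {n d : ℕ} (q : (ι → ℂ) → Fin n → Fin d → ℂ)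
    (hq : ∀ a b, IsPF (fun w => q w a b)) (e : Sym2 (Fin n)) :
    IsPF (fun w => cSqLen (q w) e) := by
  induction e using Sym2.ind with
  | _ u v =>
  simp only [cSqLen, Sym2.lift_mk, pow_two]
  exact IsPF.sum _ fun k _ => ((hq _ _).sub (hq _ _)).mul ((hq _ _).sub (hq _ _))

theorem posdet_pf {ι : Type*} {d r : ℕ} (q : (ι → ℂ) → Fin (d + r + 1) → Fin d → ℂ)
    (hq : ∀ a b, IsPF (fun w => q w a b)) :
    IsPF (fun w => (posM (q w)).toRows₁.det) :=
  IsPF.det fun i k => (hq (vtx d r (Sum.inl i)) k).sub (hq 0 k)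

theorem cSqLen_continuous {n d : ℕ} (e : Sym2 (Fin n)) :
    Continuous (fun p : Fin n → Fin d → ℂ => cSqLen p e) := by
  induction e using Sym2.ind with
  | _ u v =>
  simp only [cSqLen, Sym2.lift_mk]
  fun_prop

theorem posdet_continuous {d r : ℕ} :
    Continuous (fun p : Fin (d + r + 1) → Fin d → ℂ => (posM p).toRows₁.det) := by
  apply Continuous.matrix_det
  apply continuous_matrix
  intro i j
  simp only [posM, toRows₁, of_apply]
  fun_prop

/-- isotropic vector -/
noncomputable def eps (d : ℕ) (c : ℂ) : Fin d → ℂ :=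
  fun k => if k.val = 0 then 1 else if k.val = 1 then c else 0

theorem eps_sum {d : ℕ} (hd : 2 ≤ d) (t : ℂ) :
    ∑ k, (eps d Complex.I k + t * eps d (-Complex.I) k) ^ 2 = 4 * t := by
  obtain ⟨d', rfl⟩ := Nat.exists_eq_add_of_le' hd
  rw [Fin.sum_univ_succ, Fin.sum_univ_succ]
  simp [eps, Fin.val_succ]
  ring_nf
  simp
  ring

theorem eps_sum5 {d : ℕ} (hd : 2 ≤ d) :
    ∑ k, (eps d Complex.I k - 5 * eps d 0 k) ^ 2 = 15 := by
  obtain ⟨d', rfl⟩ := Nat.exists_eq_add_of_le' hd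
  rw [Fin.sum_univ_succ, Fin.sum_univ_succ]
  simp [eps, Fin.val_succ]
  norm_num

theorem eps_sum25 {d : ℕ} (hd : 2 ≤ d) :
    ∑ k, (5 * eps d 0 k) ^ 2 = 25 := by
  obtain ⟨d', rfl⟩ := Nat.exists_eq_add_of_le' hd
  rw [Fin.sum_univ_succ, Fin.sum_univ_succ]
  simp [eps, Fin.val_succ]
  norm_num

theorem eps_ne {d : ℕ} (hd : 2 ≤ d) (c : ℂ) : eps d c ≠ 0 := by
  intro h
  have := congrFun h ⟨0, by omega⟩
  simp [eps] at this

/-- an injective affinely spanning configuration -/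
noncomputable def vconf (d n : ℕ) (v : Fin n) : Fin d → ℂ :=
  fun k => if v.val = k.val + 1 then 1 else if d < v.val ∧ k.val = 0 then v.val else 0

theorem vconf_inj {d n : ℕ} (hd : 2 ≤ d) : Function.Injective (vconf d n) := by
  have key : ∀ u v : Fin n, u.val < v.val → vconf d n u ≠ vconf d n v := by
    intro u v huv h
    by_cases hv : v.val ≤ d
    · have := congrFun h ⟨v.val - 1, by omega⟩
      simp only [vconf] at this
      rw [if_neg (by omega), if_neg (by omega), if_pos (by omega)] at this
      exact zero_ne_one this
    · have := congrFun h ⟨0, by omega⟩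
      simp only [vconf] at this
      rw [if_neg (c := v.val = 0 + 1) (by omega), if_pos (c := d < v.val ∧ True) ⟨by omega, trivial⟩] at this
      split_ifs at this
      · have h2 : (1 : ℕ) = v.val := by exact_mod_cast this
        omega
      · have h2 : u.val = v.val := by exact_mod_cast this
        omega
      · have h2 : (0 : ℕ) = v.val := by exact_mod_cast this
        omega
  intro u v h
  rcases lt_trichotomy u.val v.val with h1 | h1 | h1
  · exact absurd h (key u v h1)
  · exact Fin.ext h1
  · exact absurd h.symm (key v u h1)

theorem vconf_zero {d n : ℕ} : vconf d (n + 1) 0 = 0 := by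
  funext k
  simp [vconf]

theorem vconf_vtx {d r : ℕ} (i : Fin d) : vconf d (d + r + 1) (vtx d r (Sum.inl i)) = Pi.single i 1 := by
  funext k
  have hv : (vtx d r (Sum.inl i)).val = i.val + 1 := by simp [vtx]
  simp only [vconf, hv]
  by_cases h : k = i
  · subst h; simp
  · have : k.val ≠ i.val := fun hh => h (Fin.ext hh)
    rw [if_neg (by omega), if_neg (by omega), Pi.single_eq_of_ne h]

theorem exists_detconf {d r : ℕ} (hd : 2 ≤ d) (i j : Fin (d + r + 1)) (hij : i ≠ j) :
    ∃ p : Fin (d + r + 1) → Fin d → ℂ, p j = p i + eps d Complex.I ∧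
      (posM p).toRows₁.det ≠ 0 := by
  have hne : vconf d (d + r + 1) j - vconf d (d + r + 1) i ≠ 0 := by
    rw [sub_ne_zero]
    exact fun h => hij (vconf_inj hd h).symm
  obtain ⟨T, hT⟩ := SeparatingDual.exists_continuousLinearEquiv_apply_eq (R := ℂ) hne
    (eps_ne hd Complex.I)
  refine ⟨fun a => T (vconf d _ a), ?_, ?_⟩
  · rw [map_sub, sub_eq_iff_eq_add] at hT
    beta_reduce
    rw [hT, add_comm]
  · have : (posM (fun a => T (vconf d (d + r + 1) a))).toRows₁ =
        (LinearMap.toMatrix' (T.toLinearEquiv : (Fin d → ℂ) →ₗ[ℂ] (Fin d → ℂ)))ᵀ := by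
      ext a b
      simp only [posM, toRows₁, of_apply, vconf_vtx, vconf_zero, map_zero, transpose_apply,
        LinearMap.toMatrix'_apply]
      simp
    rw [this, det_transpose]
    have hu := LinearEquiv.isUnit_det' T.toLinearEquiv
    rw [LinearMap.det_toMatrix']
    exact hu.ne_zero

theorem exists_pstar {d r : ℕ} (hd : 2 ≤ d) (i j : Fin (d + r + 1)) (hij : i ≠ j) :
    ∃ p : Fin (d + r + 1) → Fin d → ℂ, p j = p i + eps d Complex.I ∧
      (posM p).toRows₁.det ≠ 0 ∧
      ∀ e : Sym2 (Fin (d + r + 1)), ¬ e.IsDiag → e ≠ s(i, j) → cSqLen p e ≠ 0 := by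
  let Φ : (Fin (d + r + 1) → Fin d → ℂ) → (Fin (d + r + 1) → Fin d → ℂ) :=
    fun p => Function.update p j (p i + eps d Complex.I)
  let q : (Fin (d + r + 1) × Fin d → ℂ) → Fin (d + r + 1) → Fin d → ℂ :=
    fun w => Φ (fun a b => w (a, b))
  have hq : ∀ a b, IsPF (fun w => q w a b) := by
    intro a b
    simp only [q, Φ, Function.update_apply]
    split_ifs
    · exact (IsPF.coord _).add (IsPF.const _)
    · exact IsPF.coord _
  have hqs : ∀ p, q (fun x => p x.1 x.2) = Φ p := fun p => rfl
  let K := {e : Sym2 (Fin (d + r + 1)) // ¬ e.IsDiag ∧ e ≠ s(i, j)}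
  let F : Option K → (Fin (d + r + 1) × Fin d → ℂ) → ℂ := fun o w =>
    match o with
    | none => (posM (q w)).toRows₁.det
    | some e => cSqLen (q w) e.val
  classical
  have key : ∀ k l : Fin (d + r + 1), k ≠ l → l ≠ i → l ≠ j →
      ∃ p, cSqLen (Φ p) s(k, l) ≠ 0 := by
    intro k l hkl hli hlj
    refine ⟨Function.update 0 l (fun b => 5 * eps d 0 b), ?_⟩
    simp only [cSqLen, Sym2.lift_mk, Φ]
    by_cases hkj : k = j
    · subst hkj
      rw [Function.update_self, Function.update_of_ne hlj, Function.update_self,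
        Function.update_of_ne hli.symm]
      simp only [Pi.zero_apply, zero_add]
      rw [eps_sum5 hd]; norm_num
    · rw [Function.update_of_ne hkj, Function.update_of_ne hlj, Function.update_self,
        Function.update_of_ne hkl]
      simp only [Pi.zero_apply, zero_sub, neg_sq]
      rw [eps_sum25 hd]; norm_num
  obtain ⟨w, hw⟩ := common_pt F (by
    rintro (_ | e)
    · exact posdet_pf q hq
    · exact cSqLen_pf q hq _) (by
    rintro (_ | ⟨e, he, hne⟩)
    · obtain ⟨p, hp, hdet⟩ := exists_detconf hd i j hij
      refine ⟨fun x => p x.1 x.2, ?_⟩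
      have : Φ p = p := by
        simp only [Φ]; rw [← hp]; exact Function.update_eq_self j p
      simp only [F, hqs, this]
      exact hdet
    · suffices ∃ p, cSqLen (Φ p) e ≠ 0 by
        obtain ⟨p, hp⟩ := this
        exact ⟨fun x => p x.1 x.2, hp⟩
      induction e using Sym2.ind with
      | _ k l =>
      simp only [Sym2.mk_isDiag_iff] at he
      simp only [ne_eq, Sym2.eq_iff, not_or, not_and] at hne
      by_cases hl : l ≠ i ∧ l ≠ j
      · exact key k l he hl.1 hl.2
      · have hk : k ≠ i ∧ k ≠ j := by
          by_contra hk
          grind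
        rw [Sym2.eq_swap]
        exact key l k (Ne.symm he) hk.1 hk.2)
  refine ⟨q w, ?_, hw none, fun e he hne => hw (some ⟨e, he, hne⟩)⟩
  simp only [q, Φ]
  rw [Function.update_self, Function.update_of_ne hij]

end conf

section paths
open Matrix unitInterval

/-- generic good configurations -/
def Uc (d r : ℕ) : Set (Fin (d + r + 1) → Fin d → ℂ) :=
  {p | (∀ e : Edge (d + r + 1), cSqLen p e.val ≠ 0) ∧ (posM p).toRows₁.det ≠ 0}

/-- measurement map -/
noncomputable def meas {n d : ℕ} (p : Fin n → Fin d → ℂ) : Edge n → ℂ := fun e => cSqLen p e.val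

theorem meas_continuous {n d : ℕ} : Continuous (meas (n := n) (d := d)) :=
  continuous_pi fun e => cSqLen_continuous e.val

theorem meas_good {d r : ℕ} {p : Fin (d + r + 1) → Fin d → ℂ} (h : p ∈ Uc d r) :
    meas p ∈ goodM d (d + r + 1) :=
  ⟨⟨p, fun _ => rfl⟩, nonsing_of_det p h.2, h.1⟩

theorem sqrt_lift (γ : C(I, ℂ)) (h : ∀ t, γ t ≠ 0) (x : ℂ) (hx : x ^ 2 = γ 0) :
    ∃ Γ : C(I, ℂ), (∀ t, Γ t ^ 2 = γ t) ∧ Γ 0 = x := by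
  have cov := isCoveringMap_npow (𝕜 := ℂ) 2 (by norm_num)
  have hx0 : x ≠ 0 := by
    rintro rfl
    apply h 0
    rw [← hx]; simp
  let γ' : C(I, {x : ℂ // x ≠ 0}) := ⟨fun t => ⟨γ t, h t⟩, by fun_prop⟩
  obtain ⟨Γ, h1, h2⟩ := cov.exists_path_lifts γ' ⟨x, hx0⟩ (Subtype.ext hx.symm)
  refine ⟨⟨fun t => (Γ t).val, by fun_prop⟩, fun t => ?_, ?_⟩
  · exact congrArg Subtype.val (congrFun h1 t)
  · exact congrArg Subtype.val h2

theorem path_lift {d n : ℕ} (γ : I → (Edge n → ℂ)) (hγ : Continuous γ)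
    (hg : ∀ t, γ t ∈ goodM d n) (x : Edge n → ℂ) (hx : sqMap x = γ 0) :
    ∃ y, sqMap y = γ 1 ∧ JoinedIn (goodL d n) x y := by
  choose Γ h1 h2 using fun e => sqrt_lift ⟨fun t => γ t e, by fun_prop⟩
    (fun t => (hg t).2.2 e) (x e) (congrFun hx e)
  have hs : ∀ t, sqMap (fun e => Γ e t) = γ t := fun t => funext fun e => h1 e t
  refine ⟨fun e => Γ e 1, hs 1, ⟨⟨⟨fun t e => Γ e t, by fun_prop⟩, ?_, ?_⟩, ?_⟩⟩
  · funext e; exact h2 e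
  · rfl
  · intro t
    change sqMap (fun e => Γ e t) ∈ goodM d n
    rw [hs]
    exact hg t

theorem claimA {d r : ℕ} (q : Fin (d + r + 1) → Fin d → ℂ) (hq : q ∈ Uc d r)
    (x : Edge (d + r + 1) → ℂ) (hx : x ∈ goodL d (d + r + 1)) :
    ∃ y, sqMap y = meas q ∧ JoinedIn (goodL d (d + r + 1)) x y := by
  have hx' : sqMap x ∈ goodM d (d + r + 1) := hx
  obtain ⟨p, hp⟩ := hx'.1
  have hp' : sqMap x = meas p := funext hp
  -- the line
  let ℓ : ℂ → Fin (d + r + 1) → Fin d → ℂ := fun t => p + t • (q - p)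
  have hℓ0 : ℓ 0 = p := by simp [ℓ]
  have hℓ1 : ℓ 1 = q := by simp [ℓ]
  have hℓc : Continuous ℓ := by fun_prop
  have hpf : ∀ a b, IsPF (fun w : Unit → ℂ => ℓ (w ()) a b) := by
    intro a b
    exact (IsPF.const _).add ((IsPF.coord ()).mul (IsPF.const _))
  obtain ⟨f, hf⟩ : IsPF (fun w : Unit → ℂ => (posM (ℓ (w ()))).toRows₁.det *
      ∏ e : Edge (d + r + 1), cSqLen (ℓ (w ())) e.val) :=
    (posdet_pf _ hpf).mul (IsPF.prod _ fun e _ => cSqLen_pf _ hpf _)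
  beta_reduce at hf
  obtain ⟨P, hP⟩ := exists_line f 0 1
  have hP' : ∀ t, P.eval t = (posM (ℓ t)).toRows₁.det *
      ∏ e : Edge (d + r + 1), cSqLen (ℓ t) e.val := by
    intro t
    rw [hP, hf]
    simp
  have hU : ∀ t, P.eval t ≠ 0 → ℓ t ∈ Uc d r := by
    intro t ht
    rw [hP'] at ht
    refine ⟨fun e => ?_, left_ne_zero_of_mul ht⟩
    exact Finset.prod_ne_zero_iff.1 (right_ne_zero_of_mul ht) e (Finset.mem_univ _)
  have hP1 : P.eval 1 ≠ 0 := by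
    rw [hP', hℓ1]
    exact mul_ne_zero hq.2 (Finset.prod_ne_zero_iff.2 fun e _ => hq.1 e)
  have hP0 : P ≠ 0 := by
    rintro rfl
    simp at hP1
  let Z : Set ℂ := {t | P.eval t = 0 ∧ t ≠ 0}
  have hZ : Z.Countable := by
    refine Set.Countable.mono (s₂ := {t | P.IsRoot t}) (fun t ht => ht.1) ?_
    exact (Polynomial.finite_setOf_isRoot hP0).countable
  have hpc := hZ.isPathConnected_compl_of_one_lt_rank (by
    rw [Complex.rank_real_complex]; norm_num)
  obtain ⟨γ, hγ⟩ := hpc.joinedIn 0 (by simp [Z]) 1 (by simp [Z, hP1])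
  have hgood : ∀ t, meas (ℓ (γ t)) ∈ goodM d (d + r + 1) := by
    intro t
    by_cases h0 : γ t = 0
    · rw [h0, hℓ0, ← hp']; exact hx'
    · apply meas_good
      apply hU
      intro hz
      exact hγ t ⟨hz, h0⟩
  obtain ⟨y, hy, hj⟩ := path_lift (fun t => meas (ℓ (γ t)))
    (meas_continuous.comp (hℓc.comp γ.continuous)) hgood x (by simp [hℓ0, hp'])
  refine ⟨y, ?_, hj⟩
  rw [hy]
  simp [hℓ1]

/-- sign flip on one coordinate -/
noncomputable def flip1 {n : ℕ} (e : Edge n) (x : Edge n → ℂ) : Edge n → ℂ :=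
  fun f => if f = e then - x f else x f

theorem flip1_sq {n : ℕ} (e : Edge n) (x : Edge n → ℂ) : sqMap (flip1 e x) = sqMap x := by
  funext f
  simp only [sqMap, flip1]
  split_ifs <;> simp

theorem flip1_invol {n : ℕ} (e : Edge n) (x : Edge n → ℂ) : flip1 e (flip1 e x) = x := by
  funext f
  simp only [flip1]
  split_ifs <;> simp

theorem flip1_cont {n : ℕ} (e : Edge n) : Continuous (flip1 e) := by
  apply continuous_pi
  intro f
  simp only [flip1]
  split_ifs <;> fun_prop

theorem flip1_joined {d n : ℕ} (e : Edge n) {x y : Edge n → ℂ} (h : JoinedIn (goodL d n) x y) :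
    JoinedIn (goodL d n) (flip1 e x) (flip1 e y) := by
  obtain ⟨γ, hγ⟩ := h
  refine ⟨γ.map (flip1_cont e), fun t => ?_⟩
  change sqMap (flip1 e (γ t)) ∈ goodM d n
  rw [flip1_sq]
  exact hγ t

theorem claimB {d r : ℕ} (hd : 2 ≤ d) (e₀ : Edge (d + r + 1)) :
    ∃ q ∈ Uc d r, ∀ x, sqMap x = meas q → JoinedIn (goodL d (d + r + 1)) x (flip1 e₀ x) := by
  obtain ⟨e, he⟩ := e₀
  induction e using Sym2.ind with
  | _ i j =>
  have hij : i ≠ j := by simpa using he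
  obtain ⟨p, hp1, hp2, hp3⟩ := exists_pstar hd i j hij
  let ℓ : ℂ → Fin (d + r + 1) → Fin d → ℂ := fun t =>
    Function.update p j (p j + t • eps d (-Complex.I))
  have hℓ0 : ℓ 0 = p := by simp [ℓ]
  have hℓc : Continuous ℓ := by
    simp only [ℓ]
    fun_prop
  have hℓe : ∀ t, cSqLen (ℓ t) s(i, j) = 4 * t := by
    intro t
    rw [Sym2.eq_swap]
    simp only [cSqLen, Sym2.lift_mk, ℓ]
    rw [Function.update_self, Function.update_of_ne hij, ← eps_sum hd t]
    apply Finset.sum_congr rfl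
    intro k _
    simp only [hp1, Pi.add_apply, Pi.smul_apply, smul_eq_mul]
    ring
  have hf : ∀ e : Edge (d + r + 1), Continuous fun t => cSqLen (ℓ t) e.val := fun e =>
    (cSqLen_continuous e.val).comp hℓc
  have h0 : ∀ e : Edge (d + r + 1), e ≠ ⟨s(i, j), he⟩ → cSqLen (ℓ 0) e.val ≠ 0 := by
    intro e hne
    rw [hℓ0]
    exact hp3 _ e.2 fun h => hne (Subtype.ext h)
  have ev1 : ∀ e : Edge (d + r + 1), ∀ᶠ t in nhds (0 : ℂ), e ≠ ⟨s(i, j), he⟩ →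
      cSqLen (ℓ t) e.val / cSqLen (ℓ 0) e.val ∈ Complex.slitPlane := by
    intro e
    by_cases hne : e = ⟨s(i, j), he⟩
    · simp [hne]
    · have hc : Continuous fun t => cSqLen (ℓ t) e.val / cSqLen (ℓ 0) e.val :=
        (hf e).div_const _
      have := hc.continuousAt.eventually_mem (x := (0 : ℂ)) (s := Complex.slitPlane)
        (Complex.isOpen_slitPlane.mem_nhds (by
          rw [div_self (h0 e hne)]; exact Complex.one_mem_slitPlane))
      exact this.mono fun t ht _ => ht
  have ev2 : ∀ᶠ t in nhds (0 : ℂ), (posM (ℓ t)).toRows₁.det ≠ 0 := by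
    have hc := posdet_continuous.comp hℓc
    apply hc.continuousAt.eventually_ne
    simpa [hℓ0] using hp2
  obtain ⟨ε, hε, hball⟩ := Metric.eventually_nhds_iff.1 ((Filter.eventually_all.2 ev1).and ev2)
  let ρ : ℂ := ((ε / 2 : ℝ) : ℂ)
  have hρ0 : ρ ≠ 0 := by
    simp only [ρ]
    exact_mod_cast (half_pos hε).ne'
  let z : I → ℂ := fun θ => ρ * Complex.exp (2 * Real.pi * Complex.I * (θ : ℝ))
  have hzc : Continuous z := by fun_prop
  have hz0 : z 0 = ρ := by simp [z]
  have hz1 : z 1 = ρ := by simp [z, Complex.exp_two_pi_mul_I]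
  have hzn : ∀ θ, z θ ≠ 0 := fun θ => mul_ne_zero hρ0 (Complex.exp_ne_zero _)
  have hzd : ∀ θ, dist (z θ) 0 < ε := by
    intro θ
    have : ‖Complex.exp (2 * Real.pi * Complex.I * (θ : ℝ))‖ = 1 := by
      rw [show (2 * Real.pi * Complex.I * (θ : ℝ) : ℂ) = ((2 * Real.pi * θ : ℝ) : ℂ) * Complex.I by
        push_cast; ring]
      exact Complex.norm_exp_ofReal_mul_I _
    rw [dist_zero_right, norm_mul, this, mul_one, Complex.norm_real, Real.norm_eq_abs,
      abs_of_pos (half_pos hε)]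
    linarith
  have hU : ∀ θ, ℓ (z θ) ∈ Uc d r := by
    intro θ
    refine ⟨fun e => ?_, (hball (hzd θ)).2⟩
    by_cases hne : e = ⟨s(i, j), he⟩
    · subst hne
      rw [hℓe]
      exact mul_ne_zero (by norm_num) (hzn θ)
    · have := (hball (hzd θ)).1 e hne
      intro hzero
      rw [hzero, zero_div] at this
      exact Complex.zero_notMem_slitPlane this
  refine ⟨ℓ ρ, hz0 ▸ hU 0, fun x hx => ?_⟩
  let g : Edge (d + r + 1) → ℂ → ℂ := fun e t =>
    (cSqLen (ℓ t) e.val / cSqLen (ℓ 0) e.val) ^ (1 / 2 : ℂ)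
  have hgsq : ∀ e t, g e t ^ 2 = cSqLen (ℓ t) e.val / cSqLen (ℓ 0) e.val := by
    intro e t
    simp only [g]
    have := Complex.cpow_nat_inv_pow (cSqLen (ℓ t) e.val / cSqLen (ℓ 0) e.val) (n := 2) (by norm_num)
    simpa using this
  let X : I → Edge (d + r + 1) → ℂ := fun θ e =>
    if e = ⟨s(i, j), he⟩ then x e * Complex.exp (Real.pi * Complex.I * (θ : ℝ))
    else x e * (g e (z θ) / g e ρ)
  have hXc : Continuous X := by
    apply continuous_pi
    intro e
    simp only [X]
    split_ifs with hne
    · fun_prop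
    · apply Continuous.mul continuous_const
      apply Continuous.div_const
      apply Continuous.cpow
      · exact ((hf e).comp hzc).div_const _
      · exact continuous_const
      · intro θ
        exact (hball (hzd θ)).1 e hne
  have hXs : ∀ θ, sqMap (X θ) = meas (ℓ (z θ)) := by
    intro θ
    funext e
    have hxe : x e ^ 2 = cSqLen (ℓ ρ) e.val := congrFun hx e
    simp only [sqMap, X, meas]
    split_ifs with hne
    · subst hne
      rw [mul_pow, hxe, hℓe, hℓe, ← Complex.exp_nat_mul]
      simp only [z]
      push_cast
      ring_nf
    · have hρU : cSqLen (ℓ ρ) e.val ≠ 0 := by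
        have := (hU 0).1 e
        rwa [hz0] at this
      have hb := h0 e hne
      rw [mul_pow, div_pow, hxe, hgsq, hgsq]
      field_simp
  refine ⟨⟨⟨X, hXc⟩, ?_, ?_⟩, fun θ => ?_⟩
  · funext e
    have hρU : cSqLen (ℓ ρ) e.val ≠ 0 := by
      have := (hU 0).1 e
      rwa [hz0] at this
    simp only [X, hz0]
    split_ifs with hne
    · simp
    · have : g e ρ ≠ 0 := by
        intro h
        have := hgsq e ρ
        rw [h] at this
        exact div_ne_zero hρU (h0 e hne) (by rw [← this]; simp)
      rw [div_self this, mul_one]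
  · funext e
    have hρU : cSqLen (ℓ ρ) e.val ≠ 0 := by
      have := (hU 0).1 e
      rwa [hz0] at this
    simp only [X, hz1, flip1]
    split_ifs with hne
    · simp [Complex.exp_pi_mul_I]
    · have : g e ρ ≠ 0 := by
        intro h
        have := hgsq e ρ
        rw [h] at this
        exact div_ne_zero hρU (h0 e hne) (by rw [← this]; simp)
      rw [div_self this, mul_one]
  · change sqMap (X θ) ∈ goodM d (d + r + 1)
    rw [hXs]
    exact meas_good (hU θ)

theorem flip_joined {d r : ℕ} (hd : 2 ≤ d) (e : Edge (d + r + 1)) (x : Edge (d + r + 1) → ℂ)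
    (hx : x ∈ goodL d (d + r + 1)) : JoinedIn (goodL d (d + r + 1)) x (flip1 e x) := by
  obtain ⟨q, hq, h⟩ := claimB hd e
  obtain ⟨y, hy, hj⟩ := claimA q hq x hx
  exact (hj.trans (h y hy)).trans (flip1_joined e hj).symm

theorem flips_joined {d r : ℕ} (hd : 2 ≤ d) (S : Finset (Edge (d + r + 1))) :
    ∀ x y : Edge (d + r + 1) → ℂ, x ∈ goodL d (d + r + 1) → sqMap x = sqMap y →
      (∀ e ∉ S, x e = y e) → JoinedIn (goodL d (d + r + 1)) x y := by
  classical
  induction S using Finset.induction_on with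
  | empty =>
    intro x y hx _ h
    have : x = y := funext fun e => h e (by simp)
    subst this
    exact JoinedIn.refl hx
  | insert a S ha ih =>
    intro x y hx hs h
    by_cases hxy : x a = y a
    · apply ih x y hx hs
      intro e he
      by_cases hea : e = a
      · rw [hea, hxy]
      · exact h e (by simp [hea, he])
    · have hsa : x a ^ 2 = y a ^ 2 := congrFun hs a
      have hneg : x a = - y a := (sq_eq_sq_iff_eq_or_eq_neg.1 hsa).resolve_left hxy
      have hj := flip_joined hd a x hx
      refine hj.trans (ih _ y hj.target_mem (by rw [flip1_sq, hs]) ?_)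
      intro e he
      simp only [flip1]
      split_ifs with hea
      · rw [hea, hneg, neg_neg]
      · exact h e (by simp [hea, he])

theorem main_conn {d r : ℕ} (hd : 2 ≤ d) : IsPathConnected (goodL d (d + r + 1)) := by
  obtain ⟨q, hq, -⟩ := claimB (r := r) hd ⟨s(0, ⟨1, by omega⟩), by simp [Fin.ext_iff]⟩
  choose x₀ hx₀ using fun e => IsAlgClosed.exists_pow_nat_eq (meas q e) (n := 2) (by norm_num)
  have hs : sqMap x₀ = meas q := funext fun e => hx₀ e
  have hmem : x₀ ∈ goodL d (d + r + 1) := by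
    change sqMap x₀ ∈ goodM d (d + r + 1)
    rw [hs]; exact meas_good hq
  refine ⟨x₀, hmem, fun {x} hx => ?_⟩
  obtain ⟨y, hy, hj⟩ := claimA q hq x hx
  refine ((hj.trans (flips_joined hd Finset.univ y x₀ hj.target_mem (by rw [hy, hs]) ?_))).symm
  intro e he
  simp at he

end paths


/-- For `d ≥ 2` and `n ≥ d+2`, the good locus of `L_{d,n}` is
path-connected. -/
theorem good_locus_of_L_isPathConnected
    {d n : ℕ} (hd : 2 ≤ d) (hn : d + 2 ≤ n) :
    IsPathConnected (goodL d n) := by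
  obtain ⟨r, rfl⟩ := Nat.exists_eq_add_of_le hn
  have h := main_conn (d := d) (r := r + 1) hd
  have e : d + (r + 1) + 1 = d + 2 + r := by omega
  rw [e] at h
  exact h
end

section
/- Let d ≥ 1, n ≥ d+2, N = C(n,2), and D = C(d+2,2). Let E be a D×N complex matrix of rank r. Suppose that the image E(L_{d,n}), which is a constructible set, does not have dimension r. Then r = D and E has K_{d+2} support, i.e., all columns of E are zero except possibly the D columns indexing the edges of a single complete subgraph K_{d+2} of K_n. -/
/-- Zariski closure of a set: the smallest variety containing it. -/
def zClosure {ι : Type*} (S : Set (ι → ℂ)) : Set (ι → ℂ) :=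
  ⋂₀ {V | IsVariety V ∧ S ⊆ V}

/-- Dimension of an arbitrary (e.g. constructible) set: the dimension of its
Zariski closure. -/
noncomputable def setDim {ι : Type*} (S : Set (ι → ℂ)) : WithBot ℕ∞ :=
  varDim (zClosure S)

section DimensionPart
open MvPolynomial

lemma isVariety_zeroLocus {ι : Type*} [Finite ι] (J : Ideal (MvPolynomial ι ℂ)) :
    IsVariety (zeroLocus ℂ J) := by
  obtain ⟨S, hS⟩ := (isNoetherian_def.mp (inferInstance : IsNoetherian (MvPolynomial ι ℂ) (MvPolynomial ι ℂ))) J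
  refine ⟨S, ?_⟩
  have : J = Ideal.span (S : Set (MvPolynomial ι ℂ)) := hS.symm
  rw [this, zeroLocus_span]
  simp [aeval_eq_eval]

lemma IsVariety.zl_vi {ι : Type*} {V : Set (ι → ℂ)} (h : IsVariety V) :
    zeroLocus ℂ (vanishingIdeal ℂ V) = V := by
  apply le_antisymm
  · obtain ⟨S, rfl⟩ := h
    intro x hx f hf
    have := hx f (fun y hy => by simpa [aeval_eq_eval] using hy f hf)
    simpa [aeval_eq_eval] using this
  · exact zeroLocus_vanishingIdeal_le V

lemma IsVariety.inter {ι : Type*} [Finite ι] {V W : Set (ι → ℂ)} (hV : IsVariety V)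
    (hW : IsVariety W) : IsVariety (V ∩ W) := by
  rw [← hV.zl_vi, ← hW.zl_vi]
  have : zeroLocus ℂ (vanishingIdeal ℂ V) ∩ zeroLocus ℂ (vanishingIdeal ℂ W) =
      zeroLocus ℂ (vanishingIdeal ℂ V ⊔ vanishingIdeal ℂ W) :=
    (zeroLocus_vanishingIdeal_galoisConnection.l_sup).symm
  rw [this]
  exact isVariety_zeroLocus _

lemma isVariety_single {ι : Type*} (f : MvPolynomial ι ℂ) : IsVariety {x | eval x f = 0} :=
  ⟨{f}, by simp⟩

lemma IsIrrVariety.prime {ι : Type*} [Finite ι] {W : Set (ι → ℂ)} (h : IsIrrVariety W) :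
    (vanishingIdeal ℂ W).IsPrime := by
  obtain ⟨hv, ⟨x, hx⟩, hirr⟩ := h
  refine ⟨?_, ?_⟩
  · intro htop
    have : (1 : MvPolynomial ι ℂ) ∈ vanishingIdeal ℂ W := by rw [htop]; trivial
    simpa using this x hx
  · intro f g hfg
    have := hirr (W ∩ {x | eval x f = 0}) (W ∩ {x | eval x g = 0})
      (hv.inter (isVariety_single f)) (hv.inter (isVariety_single g)) (by
        ext y
        constructor
        · intro hy
          have := hfg y hy
          rw [map_mul, mul_eq_zero] at this
          rcases this with h | h
          · left; exact ⟨hy, by simpa [aeval_eq_eval] using h⟩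
          · right; exact ⟨hy, by simpa [aeval_eq_eval] using h⟩
        · rintro (h | h) <;> exact h.1)
    rcases this with h | h
    · left; intro y hy; rw [h] at hy; simpa [aeval_eq_eval] using hy.2
    · right; intro y hy; rw [h] at hy; simpa [aeval_eq_eval] using hy.2

lemma isIrr_zeroLocus {ι : Type*} [Finite ι] (P : Ideal (MvPolynomial ι ℂ)) [hP : P.IsPrime] :
    IsIrrVariety (zeroLocus ℂ P) := by
  have hvi : vanishingIdeal ℂ (zeroLocus ℂ P) = P := IsPrime.vanishingIdeal_zeroLocus P
  refine ⟨isVariety_zeroLocus P, ?_, ?_⟩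
  · rw [Set.nonempty_iff_ne_empty]
    intro h
    rw [h, vanishingIdeal_empty] at hvi
    exact hP.ne_top hvi.symm
  · intro V₁ V₂ h1 h2 h
    by_contra hcon
    push Not at hcon
    have key : ∀ V, IsVariety V → V ⊆ zeroLocus ℂ P → zeroLocus ℂ P ≠ V →
        ∃ f ∈ vanishingIdeal ℂ V, f ∉ P := by
      intro V hV hsub hne
      by_contra hc
      push Not at hc
      apply hne
      apply le_antisymm _ hsub
      rw [← hV.zl_vi]
      exact zeroLocus_anti_mono hc
    obtain ⟨f, hf, hfP⟩ := key V₁ h1 (h ▸ Set.subset_union_left) hcon.1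
    obtain ⟨g, hg, hgP⟩ := key V₂ h2 (h ▸ Set.subset_union_right) hcon.2
    have : f * g ∈ P := by
      rw [← hvi]
      intro x hx
      rw [h] at hx
      rw [map_mul]
      rcases hx with hx | hx
      · rw [hf x hx, zero_mul]
      · rw [hg x hx, mul_zero]
    rcases hP.mem_or_mem this with h | h <;> contradiction

noncomputable def irrIso (ι : Type*) [Finite ι] :
    {W : Set (ι → ℂ) // IsIrrVariety W ∧ W ⊆ Set.univ} ≃o
      (PrimeSpectrum (MvPolynomial ι ℂ))ᵒᵈ where
  toFun W := OrderDual.toDual ⟨vanishingIdeal ℂ W.1, W.2.1.prime⟩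
  invFun P := ⟨zeroLocus ℂ (OrderDual.ofDual P).asIdeal,
    haveI := (OrderDual.ofDual P).isPrime; isIrr_zeroLocus _, Set.subset_univ _⟩
  left_inv W := Subtype.ext W.2.1.1.zl_vi
  right_inv P := by
    have := (OrderDual.ofDual P).isPrime
    apply OrderDual.ofDual.injective
    apply PrimeSpectrum.ext
    exact IsPrime.vanishingIdeal_zeroLocus (OrderDual.ofDual P).asIdeal
  map_rel_iff' := by
    intro V W
    constructor
    · intro h
      have h' : vanishingIdeal ℂ W.1 ≤ vanishingIdeal ℂ V.1 := h
      have := zeroLocus_anti_mono (K := ℂ) h'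
      rw [V.2.1.1.zl_vi, W.2.1.1.zl_vi] at this
      exact this
    · intro h
      exact vanishingIdeal_anti_mono (k := ℂ) (show V.1 ≤ W.1 from h)

lemma varDim_univ (ι : Type*) [Finite ι] :
    varDim (Set.univ : Set (ι → ℂ)) = (Nat.card ι : WithBot ℕ∞) := by
  unfold varDim
  rw [Order.krullDim_eq_of_orderIso (irrIso ι), Order.krullDim_orderDual]
  have := MvPolynomial.ringKrullDim_of_isNoetherianRing (R := ℂ) (ι := ι)
  rw [ringKrullDim_eq_zero_of_field, zero_add] at this
  exact this

/-- linear maps as polynomial maps -/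
noncomputable def linPoly {κ ι : Type*} [Fintype κ] [DecidableEq κ]
    (φ : (κ → ℂ) →ₗ[ℂ] (ι → ℂ)) (i : ι) : MvPolynomial κ ℂ :=
  ∑ j, C (φ (Pi.single j 1) i) * X j

lemma eval_linPoly {κ ι : Type*} [Fintype κ] [DecidableEq κ]
    (φ : (κ → ℂ) →ₗ[ℂ] (ι → ℂ)) (i : ι) (x : κ → ℂ) :
    eval x (linPoly φ i) = φ x i := by
  have : x = ∑ j, x j • (Pi.single j 1 : κ → ℂ) := by
    ext k; simp [Finset.sum_apply, Pi.single_apply]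
  conv_rhs => rw [this]
  simp [linPoly, Finset.sum_apply, mul_comm]

lemma eval_bind_linPoly {κ ι : Type*} [Fintype κ] [DecidableEq κ]
    (φ : (κ → ℂ) →ₗ[ℂ] (ι → ℂ)) (f : MvPolynomial ι ℂ) (x : κ → ℂ) :
    eval x (bind₁ (linPoly φ) f) = eval (φ x) f := by
  have : eval x (bind₁ (linPoly φ) f) = eval (fun i => eval x (linPoly φ i)) f := by
    simp only [← aeval_eq_eval]
    exact aeval_bind₁ _ _ _
  rw [this]
  simp only [eval_linPoly]

lemma IsVariety.preimage {κ ι : Type*} [Fintype κ] [DecidableEq κ]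
    (φ : (κ → ℂ) →ₗ[ℂ] (ι → ℂ)) {V : Set (ι → ℂ)} (hV : IsVariety V) : IsVariety (φ ⁻¹' V) := by
  classical
  obtain ⟨S, rfl⟩ := hV
  refine ⟨S.image (bind₁ (linPoly φ)), ?_⟩
  ext x
  simp [eval_bind_linPoly]

lemma isVariety_range {κ ι : Type*} [Fintype κ] [Fintype ι]
    (φ : (κ → ℂ) →ₗ[ℂ] (ι → ℂ)) (ψ : (ι → ℂ) →ₗ[ℂ] (κ → ℂ))
    (h : ∀ x, ψ (φ x) = x) : IsVariety (Set.range φ) := by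
  classical
  have : Set.range φ = (φ ∘ₗ ψ - LinearMap.id : (ι → ℂ) →ₗ[ℂ] (ι → ℂ)) ⁻¹' {0} := by
    ext y
    constructor
    · rintro ⟨x, rfl⟩
      simp [h]
    · intro hy
      refine ⟨ψ y, ?_⟩
      simpa [sub_eq_zero] using hy
  rw [this]
  apply IsVariety.preimage
  refine ⟨Finset.univ.image X, ?_⟩
  ext x
  simp [funext_iff]

lemma IsVariety.image {κ ι : Type*} [Fintype κ] [Fintype ι]
    (φ : (κ → ℂ) →ₗ[ℂ] (ι → ℂ)) (ψ : (ι → ℂ) →ₗ[ℂ] (κ → ℂ))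
    (h : ∀ x, ψ (φ x) = x) {V : Set (κ → ℂ)} (hV : IsVariety V) : IsVariety (φ '' V) := by
  classical
  have : φ '' V = ψ ⁻¹' V ∩ Set.range φ := by
    ext y
    constructor
    · rintro ⟨x, hx, rfl⟩
      exact ⟨by simpa [h] using hx, x, rfl⟩
    · rintro ⟨hy, x, rfl⟩
      exact ⟨x, by simpa [h] using hy, rfl⟩
  rw [this]
  exact (hV.preimage ψ).inter (isVariety_range φ ψ h)

lemma varDim_range {κ ι : Type*} [Fintype κ] [Fintype ι]
    (φ : (κ → ℂ) →ₗ[ℂ] (ι → ℂ)) (ψ : (ι → ℂ) →ₗ[ℂ] (κ → ℂ))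
    (h : ∀ x, ψ (φ x) = x) : varDim (Set.range φ) = (Nat.card κ : WithBot ℕ∞) := by
  classical
  rw [← varDim_univ]
  have hinj : Function.Injective φ := Function.LeftInverse.injective h
  unfold varDim
  symm
  apply Order.krullDim_eq_of_orderIso
  refine
    { toFun := fun W => ⟨φ '' W.1, ⟨W.2.1.1.image φ ψ h, W.2.1.2.1.image φ, ?_⟩,
        Set.image_subset_range _ _⟩
      invFun := fun W => ⟨φ ⁻¹' W.1, ⟨W.2.1.1.preimage φ, ?_, ?_⟩, Set.subset_univ _⟩
      left_inv := fun W => Subtype.ext (Set.preimage_image_eq _ hinj)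
      right_inv := fun W => Subtype.ext (Set.image_preimage_eq_of_subset W.2.2)
      map_rel_iff' := ?_ }
  · intro V₁ V₂ h1 h2 hU
    have := W.2.1.2.2 _ _ (h1.preimage φ) (h2.preimage φ) (by
      rw [← Set.preimage_union, ← hU, Set.preimage_image_eq _ hinj])
    have hs1 : V₁ ⊆ Set.range φ := fun y hy =>
      Set.image_subset_range φ W.1 (hU ▸ Or.inl hy)
    have hs2 : V₂ ⊆ Set.range φ := fun y hy =>
      Set.image_subset_range φ W.1 (hU ▸ Or.inr hy)
    rcases this with h | h
    · left; rw [h, Set.image_preimage_eq_of_subset hs1]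
    · right; rw [h, Set.image_preimage_eq_of_subset hs2]
  · obtain ⟨y, hy⟩ := W.2.1.2.1
    obtain ⟨x, rfl⟩ := W.2.2 hy
    exact ⟨x, hy⟩
  · intro V₁ V₂ h1 h2 hU
    have := W.2.1.2.2 _ _ (h1.image φ ψ h) (h2.image φ ψ h) (by
      rw [← Set.image_union, ← hU, Set.image_preimage_eq_of_subset W.2.2])
    rcases this with h | h
    · left; rw [h, Set.preimage_image_eq _ hinj]
    · right; rw [h, Set.preimage_image_eq _ hinj]
  · intro V W
    exact Set.image_subset_image_iff hinj

/-- If a set lies in the range of an injective linear map and its pullback contains a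
nonempty Euclidean-open set, its dimension is the full dimension. -/
lemma setDim_of_nhds {κ ι : Type*} [Fintype κ] [Fintype ι]
    (φ : (κ → ℂ) →ₗ[ℂ] (ι → ℂ)) (ψ : (ι → ℂ) →ₗ[ℂ] (κ → ℂ))
    (h : ∀ x, ψ (φ x) = x) (S : Set (κ → ℂ)) (a : κ → ℂ) (hS : S ∈ nhds a) :
    setDim (φ '' S) = (Nat.card κ : WithBot ℕ∞) := by
  classical
  rw [← varDim_range φ ψ h]
  unfold setDim
  congr 1
  apply le_antisymm
  · exact Set.sInter_subset_of_mem ⟨isVariety_range φ ψ h, Set.image_subset_range _ _⟩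
  · rintro _ ⟨x, rfl⟩ V ⟨⟨T, rfl⟩, hsub⟩ f hf
    rw [← eval_bind_linPoly]
    have : bind₁ (linPoly φ) f = 0 := by
      obtain ⟨ε, hε, hball⟩ := Metric.mem_nhds_iff.mp hS
      apply funext_set (fun i => Metric.ball (a i) ε)
      · intro i
        exact infinite_of_mem_nhds (a i) (Metric.ball_mem_nhds _ hε)
      · intro y hy
        rw [eval_bind_linPoly, map_zero]
        refine hsub ⟨y, hball ?_, rfl⟩ f hf
        rw [ball_pi _ hε]
        exact hy
    rw [this, map_zero]

end DimensionPart

lemma exists_signs_det {κ : Type*} [Fintype κ] [DecidableEq κ] (M : Matrix κ κ ℂ) :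
    ∃ σ : κ → ℂ, (∀ i, σ i ^ 2 = 1) ∧ (Matrix.diagonal σ + M).det ≠ 0 := by
  have key : ∀ s : Finset κ, ∃ σ : κ → ℂ, (∀ i, σ i ^ 2 = 1) ∧
      (Matrix.of fun i => if i ∈ s then σ i • (Pi.single i 1 : κ → ℂ) + M i
        else Pi.single i 1).det ≠ 0 := by
    intro s
    induction s using Finset.induction_on with
    | empty =>
      refine ⟨1, by simp, ?_⟩
      have : (Matrix.of fun i => if i ∈ (∅ : Finset κ) then (1 : κ → ℂ) i • (Pi.single i 1 : κ → ℂ) + M i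
        else Pi.single i 1) = (1 : Matrix κ κ ℂ) := by
        ext i j; simp [Matrix.one_apply, Pi.single_apply, eq_comm]
      rw [this]; simp
    | insert a s ha ih =>
      obtain ⟨σ, hσ, hdet⟩ := ih
      set A : Matrix κ κ ℂ := (Matrix.of fun i => if i ∈ s then σ i • (Pi.single i 1 : κ → ℂ) + M i
        else Pi.single i 1) with hA
      have hup : ∀ c : ℂ, (Matrix.of fun i => if i ∈ insert a s then
          (Function.update σ a c) i • (Pi.single i 1 : κ → ℂ) + M i else Pi.single i 1)
          = A.updateRow a (c • (Pi.single a 1 : κ → ℂ) + M a) := by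
        intro c
        ext i j
        by_cases hi : i = a
        · subst hi; simp
        · simp [hi, hA]
      have hAa : A.updateRow a (Pi.single a 1) = A := by
        ext i j
        by_cases hi : i = a
        · subst hi; simp [hA, ha]
        · simp [Matrix.updateRow_ne hi]
      have hd : ∀ c : ℂ, (A.updateRow a (c • (Pi.single a 1 : κ → ℂ) + M a)).det
          = c * A.det + (A.updateRow a (M a)).det := by
        intro c
        rw [Matrix.det_updateRow_add, Matrix.det_updateRow_smul, hAa]
      by_cases h1 : (A.updateRow a ((1:ℂ) • (Pi.single a 1 : κ → ℂ) + M a)).det = 0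
      · refine ⟨Function.update σ a (-1), ?_, ?_⟩
        · intro i
          by_cases hi : i = a
          · subst hi; simp
          · simp [hi, hσ]
        · rw [hup]
          intro h2
          rw [hd] at h1 h2
          apply hdet
          linear_combination (h1 - h2) / 2
      · refine ⟨Function.update σ a 1, ?_, ?_⟩
        · intro i
          by_cases hi : i = a
          · subst hi; simp
          · simp [hi, hσ]
        · rw [hup]; exact h1
  obtain ⟨σ, hσ, h⟩ := key Finset.univ
  refine ⟨σ, hσ, ?_⟩
  convert h using 2
  ext i j
  simp [Matrix.diagonal_apply, Pi.single_apply, eq_comm]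

section RigidityPart

/-- moment curve configuration -/
noncomputable def momCurve (n d : ℕ) : Fin n → Fin d → ℂ := fun i k => ((i : ℕ) : ℂ) ^ ((k : ℕ) + 1)

noncomputable def bilEdge {n d : ℕ} (p q : Fin n → Fin d → ℂ) : Sym2 (Fin n) → ℂ :=
  Sym2.lift ⟨fun i j => ∑ k, (p i k - p j k) * (q i k - q j k),
    fun i j => Finset.sum_congr rfl fun k _ => by ring⟩

lemma bilEdge_mk {n d : ℕ} (p q : Fin n → Fin d → ℂ) (i j : Fin n) :
    bilEdge p q s(i, j) = ∑ k, (p i k - p j k) * (q i k - q j k) := rfl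

lemma cSqLen_mk {n d : ℕ} (p : Fin n → Fin d → ℂ) (i j : Fin n) :
    cSqLen p s(i, j) = ∑ k, (p i k - p j k) ^ 2 := rfl

lemma momCurve_poly {n d : ℕ} (i j : Fin n) (f : Polynomial ℂ) (hf : f.natDegree ≤ d) :
    ∑ k : Fin d, (momCurve n d i k - momCurve n d j k) * f.coeff (k + 1) =
      f.eval ((i : ℕ) : ℂ) - f.eval ((j : ℕ) : ℂ) := by
  rw [Polynomial.eval_eq_sum_range' (Nat.lt_succ_of_le hf),
    Polynomial.eval_eq_sum_range' (Nat.lt_succ_of_le hf), ← Finset.sum_sub_distrib,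
    Finset.sum_range_succ', ← Fin.sum_univ_eq_sum_range
      (fun k => f.coeff (k+1) * ((i : ℕ) : ℂ) ^ (k+1) - f.coeff (k+1) * ((j : ℕ) : ℂ) ^ (k+1))]
  simp only [pow_zero, sub_self, add_zero]
  exact Finset.sum_congr rfl fun k _ => by simp only [momCurve]; ring

/-- support graph of a stress -/
def supGraph {n : ℕ} (w : Edge n → ℂ) : SimpleGraph (Fin n) where
  Adj i j := ∃ h : ¬ (s(i, j)).IsDiag, w ⟨s(i, j), h⟩ ≠ 0
  symm := ⟨by
    rintro i j ⟨h, hw⟩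
    have : s(i, j) = s(j, i) := Sym2.eq_swap
    refine ⟨this ▸ h, ?_⟩
    convert hw using 3
    exact this.symm⟩
  loopless := ⟨by
    rintro i ⟨h, _⟩
    exact h (by simp)⟩

open Classical in
lemma degree_bound {n d : ℕ} (w : Edge n → ℂ)
    (hw : ∀ q : Fin n → Fin d → ℂ, ∑ e, w e * bilEdge (momCurve n d) q e.val = 0)
    {i j : Fin n} (hij : (supGraph w).Adj i j) : d + 1 ≤ (supGraph w).degree i := by
  by_contra hlt
  have hdeg : (supGraph w).degree i ≤ d := by omega
  set G := supGraph w with hG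
  have hj : j ∈ G.neighborFinset i := by simpa using hij
  let f : Polynomial ℂ := (Polynomial.X - Polynomial.C ((i : ℕ) : ℂ)) *
    ∏ m ∈ (G.neighborFinset i).erase j, (Polynomial.X - Polynomial.C ((m : ℕ) : ℂ))
  have hcard : ((G.neighborFinset i).erase j).card + 1 = G.degree i := by
    rw [Finset.card_erase_add_one hj]; rfl
  have hfdeg : f.natDegree ≤ d := by
    refine Polynomial.natDegree_mul_le.trans ?_
    rw [Polynomial.natDegree_X_sub_C, Polynomial.natDegree_prod_of_monic _ _
      (fun m _ => Polynomial.monic_X_sub_C _)]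
    simp only [Polynomial.natDegree_X_sub_C, Finset.sum_const, smul_eq_mul, mul_one]
    omega
  have hcast : ∀ a b : Fin n, ((a : ℕ) : ℂ) - ((b : ℕ) : ℂ) = 0 → a = b := by
    intro a b h
    rw [sub_eq_zero] at h
    exact Fin.ext (by exact_mod_cast h)
  have hfi : f.eval ((i : ℕ) : ℂ) = 0 := by simp [f]
  have hfj : f.eval ((j : ℕ) : ℂ) ≠ 0 := by
    simp only [f, Polynomial.eval_mul, Polynomial.eval_prod, Polynomial.eval_sub,
      Polynomial.eval_X, Polynomial.eval_C]
    apply mul_ne_zero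
    · intro h; exact hij.ne (hcast _ _ h).symm
    · rw [Finset.prod_ne_zero_iff]
      intro m hm h
      exact (Finset.ne_of_mem_erase hm) (hcast _ _ h).symm
  have hfm : ∀ m, G.Adj i m → m ≠ j → f.eval ((m : ℕ) : ℂ) = 0 := by
    intro m hm hne
    simp only [f, Polynomial.eval_mul, Polynomial.eval_prod, Polynomial.eval_sub,
      Polynomial.eval_X, Polynomial.eval_C]
    rw [Finset.prod_eq_zero (i := m)]
    · simp
    · simp [hne, hm]
    · simp
  obtain ⟨hd, hwij⟩ := hij
  have key := hw (fun a k => if a = i then f.coeff (k + 1) else 0)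
  have hval : ∀ m, m ≠ i → bilEdge (momCurve n d)
      (fun a (k : Fin d) => if a = i then f.coeff (k + 1) else 0) s(i, m) =
      f.eval ((i : ℕ) : ℂ) - f.eval ((m : ℕ) : ℂ) := by
    intro m hm
    rw [bilEdge_mk, ← momCurve_poly i m f hfdeg]
    simp [hm]
  rw [Finset.sum_eq_single ⟨s(i, j), hd⟩] at key
  · rw [hval j (by rintro rfl; exact hd (by simp)), hfi, zero_sub] at key
    exact mul_ne_zero hwij (neg_ne_zero.mpr hfj) key
  · rintro ⟨e, he⟩ - hne
    by_cases hw0 : w ⟨e, he⟩ = 0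
    · rw [hw0, zero_mul]
    apply mul_eq_zero_of_right
    by_cases hie : i ∈ e
    · obtain ⟨m, rfl⟩ := hie
      have hmi : m ≠ i := by rintro rfl; exact he (by simp)
      have hmj : m ≠ j := by rintro rfl; exact hne rfl
      show bilEdge _ _ s(i, m) = 0
      rw [hval m hmi, hfi, hfm m ⟨he, hw0⟩ hmj, sub_zero]
    · revert hie he hne
      induction e using Sym2.ind with
      | _ a b =>
        intro he _ _ hie
        simp only [Sym2.mem_iff, not_or] at hie
        show bilEdge _ _ s(a, b) = 0
        rw [bilEdge_mk]
        simp [Ne.symm hie.1, Ne.symm hie.2]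
  · simp

open Classical in
lemma graph_count {V : Type*} [Fintype V] (G : SimpleGraph V) (d : ℕ)
    (hE : 2 * G.edgeFinset.card ≤ (d + 2) * (d + 1))
    (hdeg : ∀ i j, G.Adj i j → d + 1 ≤ G.degree i) {a b : V} (hab : G.Adj a b) :
    2 * G.edgeFinset.card = (d + 2) * (d + 1) ∧
    ∃ S : Finset V, S.card = d + 2 ∧ ∀ i j, G.Adj i j ↔ (i ≠ j ∧ i ∈ S ∧ j ∈ S) := by
  let S : Finset V := Finset.univ.filter fun i => ∃ j, G.Adj i j
  have hmem : ∀ i, i ∈ S ↔ ∃ j, G.Adj i j := by intro i; simp [S]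
  have hnb : ∀ i, G.neighborFinset i ⊆ S.erase i := by
    intro i j hj
    have hj' : G.Adj i j := by simpa using hj
    exact Finset.mem_erase.mpr ⟨hj'.ne', (hmem j).2 ⟨i, hj'.symm⟩⟩
  have hdS : ∀ i ∈ S, d + 1 ≤ G.degree i := by
    intro i hi
    obtain ⟨j, hj⟩ := (hmem i).1 hi
    exact hdeg i j hj
  have hsum : ∑ i ∈ S, G.degree i = 2 * G.edgeFinset.card := by
    rw [← G.sum_degrees_eq_twice_card_edges]
    apply Finset.sum_subset (Finset.subset_univ S)
    intro i _ hi
    by_contra h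
    apply hi
    rw [hmem]
    have := (G.degree_pos_iff_exists_adj i).1 (Nat.pos_of_ne_zero h)
    exact this
  have hlow : S.card * (d + 1) ≤ 2 * G.edgeFinset.card := by
    rw [← hsum, ← smul_eq_mul]
    exact Finset.card_nsmul_le_sum S _ _ hdS
  have hup : S.card ≤ d + 2 := Nat.le_of_mul_le_mul_right (hlow.trans hE) (Nat.succ_pos d)
  have hdle : ∀ i ∈ S, G.degree i ≤ S.card - 1 := by
    intro i hi
    have := Finset.card_le_card (hnb i)
    rwa [Finset.card_erase_of_mem hi] at this
  have haS : a ∈ S := (hmem a).2 ⟨b, hab⟩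
  have hge : d + 2 ≤ S.card := by
    have h1 := hdS a haS
    have h2 := hdle a haS
    omega
  have hS : S.card = d + 2 := le_antisymm hup hge
  refine ⟨?_, S, hS, ?_⟩
  · apply le_antisymm hE
    rw [hS] at hlow
    exact hlow
  · intro i j
    constructor
    · intro h
      exact ⟨h.ne, (hmem i).2 ⟨j, h⟩, (hmem j).2 ⟨i, h.symm⟩⟩
    · rintro ⟨hne, hi, hj⟩
      have : G.neighborFinset i = S.erase i := by
        apply Finset.eq_of_subset_of_card_le (hnb i)
        rw [Finset.card_erase_of_mem hi]
        have := hdS i hi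
        rw [← SimpleGraph.card_neighborFinset_eq_degree] at this
        omega
      have hj' : j ∈ G.neighborFinset i := by
        rw [this]; exact Finset.mem_erase.mpr ⟨hne.symm, hj⟩
      simpa using hj'

lemma stress_support {n d : ℕ} (I : Finset (Edge n)) (hI : I.card ≤ (d + 2).choose 2)
    (w : Edge n → ℂ) (hwI : ∀ e, e ∉ I → w e = 0) {e₀ : Edge n} (he₀ : w e₀ ≠ 0)
    (hw : ∀ q : Fin n → Fin d → ℂ, ∑ e, w e * bilEdge (momCurve n d) q e.val = 0) :
    I.card = (d + 2).choose 2 ∧ ∃ S : Finset (Fin n), S.card = d + 2 ∧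
      ∀ e : Edge n, e ∈ I ↔ ∀ a ∈ e.val, a ∈ S := by
  classical
  have hD : 2 * (d + 2).choose 2 = (d + 2) * (d + 1) := by
    rw [Nat.choose_two_right]
    have : 2 ∣ (d + 2) * (d + 2 - 1) := by
      simpa [mul_comm] using (Nat.even_mul_succ_self (d+1)).two_dvd
    rw [Nat.mul_div_cancel' this]; rfl
  set G := supGraph w with hG
  have hsub : G.edgeFinset ⊆ I.map (Function.Embedding.subtype _) := by
    intro e he
    rw [SimpleGraph.mem_edgeFinset] at he
    induction e using Sym2.ind with
    | _ a b =>
      obtain ⟨h, hw0⟩ := (SimpleGraph.mem_edgeSet G).1 he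
      simp only [Finset.mem_map]
      refine ⟨⟨s(a, b), h⟩, ?_, rfl⟩
      by_contra hn
      exact hw0 (hwI _ hn)
  have hcard := Finset.card_le_card hsub
  rw [Finset.card_map] at hcard
  obtain ⟨⟨e, he⟩, rfl⟩ : ∃ e, e = e₀ := ⟨_, rfl⟩
  induction e using Sym2.ind with
  | _ a b =>
    have hab : G.Adj a b := ⟨he, he₀⟩
    obtain ⟨h1, S, hS, hadj⟩ := graph_count G d (by omega)
      (fun i j hij => degree_bound w hw hij) hab
    refine ⟨by omega, S, hS, ?_⟩
    have heq : G.edgeFinset = I.map (Function.Embedding.subtype _) := by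
      apply Finset.eq_of_subset_of_card_le hsub
      rw [Finset.card_map]; omega
    rintro ⟨e, he⟩
    have : (⟨e, he⟩ : Edge n) ∈ I ↔ e ∈ G.edgeFinset := by
      rw [heq]; simp [he]
    rw [this, SimpleGraph.mem_edgeFinset]
    induction e using Sym2.ind with
    | _ x y =>
      rw [SimpleGraph.mem_edgeSet, hadj]
      have : x ≠ y := by rintro rfl; exact he (by simp)
      simp [this]

end RigidityPart

section DerivPart

lemma cSqLen_deriv {n d : ℕ} (p : Fin n → Fin d → ℂ) (e : Sym2 (Fin n)) :
    ∃ L : (Fin n → Fin d → ℂ) →L[ℂ] ℂ, (∀ q, L q = 2 * bilEdge p q e) ∧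
      HasStrictFDerivAt (fun q => cSqLen q e) L p := by
  induction e using Sym2.ind with
  | _ i j =>
    have h0 : ∀ (a : Fin n) (k : Fin d), HasStrictFDerivAt (fun q : Fin n → Fin d → ℂ => q a k)
        ((ContinuousLinearMap.proj k : (Fin d → ℂ) →L[ℂ] ℂ) ∘L
          (ContinuousLinearMap.proj a : (Fin n → Fin d → ℂ) →L[ℂ] (Fin d → ℂ))) p := fun a k =>
      ((ContinuousLinearMap.proj k : (Fin d → ℂ) →L[ℂ] ℂ) ∘L
          (ContinuousLinearMap.proj a : (Fin n → Fin d → ℂ) →L[ℂ] (Fin d → ℂ))).hasStrictFDerivAt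
    have h1 := HasStrictFDerivAt.fun_sum (u := Finset.univ)
      (fun k _ => ((h0 i k).sub (h0 j k)).pow 2)
    refine ⟨_, ?_, h1⟩
    intro q
    rw [bilEdge_mk, Finset.mul_sum]
    simp
    exact Finset.sum_congr rfl fun k _ => by ring

lemma momCurve_pos {n d : ℕ} (hd : 1 ≤ d) (e : Edge n) :
    cSqLen (momCurve n d) e.val ∈ Complex.slitPlane := by
  obtain ⟨e, he⟩ := e
  induction e using Sym2.ind with
  | _ i j =>
    have hij : i ≠ j := by rintro rfl; exact he (by simp)
    show cSqLen _ s(i, j) ∈ _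
    rw [cSqLen_mk]
    have : (∑ k, (momCurve n d i k - momCurve n d j k) ^ 2) =
      ((∑ k : Fin d, (((i : ℕ) : ℝ) ^ ((k : ℕ) + 1) - ((j : ℕ) : ℝ) ^ ((k : ℕ) + 1)) ^ 2 : ℝ) : ℂ) := by
      simp [momCurve]
    rw [this, Complex.ofReal_mem_slitPlane]
    apply Finset.sum_pos' (fun k _ => sq_nonneg _)
    refine ⟨⟨0, hd⟩, Finset.mem_univ _, ?_⟩
    have : ((i : ℕ) : ℝ) - ((j : ℕ) : ℝ) ≠ 0 := by
      rw [sub_ne_zero]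
      intro h
      exact hij (Fin.ext (by exact_mod_cast h))
    simpa using (sq_pos_of_ne_zero this)

lemma sqrt_deriv {n d : ℕ} (hd : 1 ≤ d) (e : Edge n) :
    ∃ c : ℂ, c ≠ 0 ∧ ∃ L : (Fin n → Fin d → ℂ) →L[ℂ] ℂ,
      (∀ q, L q = c * bilEdge (momCurve n d) q e.val) ∧
      HasStrictFDerivAt (fun q => (cSqLen q e.val) ^ (1 / 2 : ℂ)) L (momCurve n d) := by
  obtain ⟨L, hL, hder⟩ := cSqLen_deriv (momCurve n d) e.val
  have hs := momCurve_pos hd e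
  have hx : cSqLen (momCurve n d) e.val ≠ 0 := Complex.slitPlane_ne_zero hs
  have h := (Complex.hasStrictDerivAt_cpow_const (c := (1 / 2 : ℂ)) hs).comp_hasStrictFDerivAt
    (f := fun q : Fin n → Fin d → ℂ => cSqLen q e.val) (momCurve n d) hder
  refine ⟨(1 / 2 : ℂ) * cSqLen (momCurve n d) e.val ^ (1 / 2 - 1 : ℂ) * 2, ?_, _, ?_, h⟩
  · simp [Complex.cpow_eq_zero_iff, hx]
  · intro q
    simp only [ContinuousLinearMap.smul_apply, smul_eq_mul, hL]
    ring

end DerivPart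

section FinalPart

lemma surj_of_cols {κ V : Type*} [Fintype κ] [DecidableEq κ] [AddCommGroup V] [Module ℂ V]
    [TopologicalSpace V]
    (T : V →L[ℂ] (κ → ℂ)) (A : Matrix κ κ ℂ) (hA : A.det ≠ 0) (qb : κ → V)
    (hcol : ∀ b, T (qb b) = A.col b) (y : κ → ℂ) : ∃ q, T q = y := by
  have hu : IsUnit A.det := isUnit_iff_ne_zero.mpr hA
  refine ⟨∑ b, (A⁻¹.mulVec y) b • qb b, ?_⟩
  have : T (∑ b, (A⁻¹.mulVec y) b • qb b) = A.mulVec (A⁻¹.mulVec y) := by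
    rw [map_sum]
    generalize A⁻¹.mulVec y = z
    ext a
    simp [hcol, Matrix.mulVec, dotProduct, mul_comm]
  rw [this, Matrix.mulVec_mulVec, Matrix.mul_nonsing_inv _ hu, Matrix.one_mulVec]

lemma image_nhds {d n : ℕ} (I : Finset (Edge n))
    (C : (Edge n → ℂ) →ₗ[ℂ] (I → ℂ)) (hC : ∀ b : I, C (Pi.single b.1 1) = Pi.single b 1)
    (L : Edge n → (Fin n → Fin d → ℂ) →L[ℂ] ℂ)
    (hder : ∀ e : Edge n, HasStrictFDerivAt (fun q => (cSqLen q e.val) ^ (1 / 2 : ℂ)) (L e)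
      (momCurve n d))
    (hsurj : Function.Surjective
      (LinearMap.pi fun e : I => (L e.1 : (Fin n → Fin d → ℂ) →ₗ[ℂ] ℂ))) :
    ∃ a, C '' Lvar d n ∈ nhds a := by
  classical
  have hB : ∀ b : I, ∃ q : Fin n → Fin d → ℂ, ∀ e : I, L e.1 q = if e = b then 1 else 0 := by
    intro b
    obtain ⟨q, hq⟩ := hsurj (Pi.single b 1)
    refine ⟨q, fun e => ?_⟩
    have := congrFun hq e
    simpa [Pi.single_apply] using this
  choose qb hqb using hB
  let M : Matrix I I ℂ := Matrix.of fun a b => C (fun e => if e ∈ I then 0 else L e (qb b)) a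
  obtain ⟨σ, hσ, hdet⟩ := exists_signs_det M
  let τ : Edge n → ℂ := fun e => if h : e ∈ I then σ ⟨e, h⟩ else 1
  have hτ : ∀ e, τ e ^ 2 = 1 := by
    intro e
    by_cases h : e ∈ I
    · simp [τ, h, hσ]
    · simp [τ, h]
  let C' : (Edge n → ℂ) →L[ℂ] (I → ℂ) := LinearMap.toContinuousLinearMap C
  let Lτ : (Fin n → Fin d → ℂ) →L[ℂ] (Edge n → ℂ) := ContinuousLinearMap.pi fun e => τ e • L e
  have hF : HasStrictFDerivAt
      (fun q : Fin n → Fin d → ℂ => fun e : Edge n => τ e * (cSqLen q e.val) ^ (1 / 2 : ℂ)) Lτ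
      (momCurve n d) := by
    rw [hasStrictFDerivAt_pi']
    intro e
    exact (hder e).const_mul (τ e)
  have hG : HasStrictFDerivAt (fun q : Fin n → Fin d → ℂ =>
      C' (fun e : Edge n => τ e * (cSqLen q e.val) ^ (1 / 2 : ℂ))) (C' ∘L Lτ) (momCurve n d) :=
    C'.hasStrictFDerivAt.comp _ hF
  have hcol : ∀ b : I, (C' ∘L Lτ) (qb b) = (Matrix.diagonal σ + M).col b := by
    intro b
    have h1 : Lτ (qb b) = σ b • Pi.single b.1 1 + fun e => if e ∈ I then 0 else L e (qb b) := by
      ext e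
      by_cases h : e ∈ I
      · have := hqb b ⟨e, h⟩
        by_cases hb : e = b.1
        · subst hb
          simp [Lτ, τ, hqb]
        · have hne : (⟨e, h⟩ : I) ≠ b := fun h' => hb (congrArg Subtype.val h')
          simp [hne] at this
          simp [Lτ, this, hb, h]
      · have hb : e ≠ b.1 := by rintro rfl; exact h b.2
        simp [Lτ, τ, h, hb]
    show C (Lτ (qb b)) = _
    rw [h1, map_add, map_smul, hC]
    ext a
    simp only [Matrix.col_apply, Matrix.add_apply, M, Matrix.of_apply, Pi.add_apply, Pi.smul_apply,
      smul_eq_mul, Pi.single_apply, Matrix.diagonal_apply]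
    congr 1
    by_cases hab : a = b
    · simp [hab]
    · simp [hab]
  have hrange : (C' ∘L Lτ).range = ⊤ := by
    rw [eq_top_iff]
    intro y _
    exact surj_of_cols _ _ hdet qb hcol y
  refine ⟨C' (fun e : Edge n => τ e * (cSqLen (momCurve n d) e.val) ^ (1 / 2 : ℂ)), ?_⟩
  · rw [← hG.map_nhds_eq_of_surj hrange, Filter.mem_map]
    apply Filter.univ_mem'
    intro q
    refine ⟨fun e : Edge n => τ e * (cSqLen q e.val) ^ (1 / 2 : ℂ), ⟨q, fun e => ?_⟩, rfl⟩
    show (τ e * (cSqLen q e.val) ^ (1 / 2 : ℂ)) ^ 2 = _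
    rw [mul_pow, hτ, one_mul, ← Complex.cpow_nat_mul]
    simp

lemma basis_is_K {d n : ℕ} (hd : 1 ≤ d)
    (E : Matrix (Fin ((d + 2).choose 2)) (Edge n) ℂ) (I : Finset (Edge n))
    (hli : LinearIndependent ℂ (fun e : I => E.col e.1)) (hcard : I.card = E.rank)
    (hdim : setDim ((fun x => E.mulVec x) '' Lvar d n) ≠ (I.card : WithBot ℕ∞)) :
    I.card = (d + 2).choose 2 ∧ ∃ S : Finset (Fin n), S.card = d + 2 ∧
      ∀ e : Edge n, e ∈ I ↔ ∀ a ∈ e.val, a ∈ S := by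
  classical
  have hle : I.card ≤ (d + 2).choose 2 := by
    rw [hcard]; simpa using E.rank_le_card_height
  choose c hc L hL hder using fun e : Edge n => sqrt_deriv (d := d) hd e
  by_cases hsurj : Function.Surjective
      (LinearMap.pi fun e : I => (L e.1 : (Fin n → Fin d → ℂ) →ₗ[ℂ] ℂ))
  · exfalso
    apply hdim
    let φ : (I → ℂ) →ₗ[ℂ] (Fin ((d + 2).choose 2) → ℂ) :=
      Fintype.linearCombination ℂ (fun e : I => E.col e.1)
    have hφs : ∀ b : I, φ (Pi.single b 1) = E.col b.1 := by
      intro b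
      simp [φ, Fintype.linearCombination_apply_single]
    have hinj : Function.Injective φ := hli.fintypeLinearCombination_injective
    obtain ⟨ψ, hψ⟩ := LinearMap.exists_leftInverse_of_injective φ (LinearMap.ker_eq_bot.mpr hinj)
    have hψ' : ∀ x, ψ (φ x) = x := fun x => LinearMap.congr_fun hψ x
    have hr : LinearMap.range φ = LinearMap.range E.mulVecLin := by
      apply Submodule.eq_of_le_of_finrank_eq
      · rw [Matrix.range_mulVecLin, Fintype.range_linearCombination]
        apply Submodule.span_mono
        rintro _ ⟨e, rfl⟩
        exact ⟨e.1, rfl⟩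
      · rw [LinearMap.finrank_range_of_inj hinj]
        simp [hcard, Matrix.rank]
    have hEs : ∀ e, E.mulVecLin (Pi.single e 1) = E.col e := by
      intro e; simp
    let C := ψ ∘ₗ E.mulVecLin
    have hC : ∀ b : I, C (Pi.single b.1 1) = Pi.single b 1 := by
      intro b
      show ψ (E.mulVecLin _) = _
      rw [hEs, ← hφs, hψ']
    have hfac : ∀ x, E.mulVec x = φ (C x) := by
      intro x
      obtain ⟨y, hy⟩ : E.mulVecLin x ∈ LinearMap.range φ := hr ▸ ⟨x, rfl⟩
      show E.mulVecLin x = φ (ψ (E.mulVecLin x))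
      rw [← hy, hψ']
    obtain ⟨a, ha⟩ := image_nhds I C hC L hder hsurj
    have := setDim_of_nhds φ ψ hψ' _ a ha
    rw [Set.image_image] at this
    simp_rw [hfac]
    rw [this]
    simp
  · rw [← LinearMap.range_eq_top] at hsurj
    obtain ⟨f, hf, hker⟩ := Submodule.exists_le_ker_of_lt_top _ (lt_top_iff_ne_top.mpr hsurj)
    have hfx : ∀ x : I → ℂ, f x = ∑ b, x b * f (Pi.single b 1) := by
      intro x
      have : x = ∑ j, x j • (Pi.single j 1 : I → ℂ) := by
        ext k; simp [Finset.sum_apply, Pi.single_apply]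
      conv_lhs => rw [this]
      simp
    obtain ⟨b, hb⟩ : ∃ b : I, f (Pi.single b 1) ≠ 0 := by
      by_contra hcon
      push Not at hcon
      apply hf
      ext x
      simp [hcon]
    let w : Edge n → ℂ := fun e => if h : e ∈ I then f (Pi.single ⟨e, h⟩ 1) * c e else 0
    refine stress_support I hle w (fun e he => by simp [w, he]) (e₀ := b.1) ?_ ?_
    · simp [w, hb, hc]
    · intro q
      have h0 : f (LinearMap.pi (fun e : I => (L e.1 : (Fin n → Fin d → ℂ) →ₗ[ℂ] ℂ)) q) = 0 :=
        hker ⟨q, rfl⟩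
      rw [hfx] at h0
      rw [← h0, ← Finset.sum_subset (Finset.subset_univ I), ← Finset.sum_coe_sort]
      · apply Finset.sum_congr rfl
        intro e _
        simp [w, hL]
        ring
      · intro e _ he
        simp [w, he]

lemma two_K {d n : ℕ} (hd : 1 ≤ d) {I I' : Finset (Edge n)} {S S' : Finset (Fin n)}
    (hS' : S'.card = d + 2)
    (hI : ∀ e : Edge n, e ∈ I ↔ ∀ a ∈ e.val, a ∈ S)
    (hI' : ∀ e : Edge n, e ∈ I' ↔ ∀ a ∈ e.val, a ∈ S') {e : Edge n} (he' : e ∈ I')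
    (he : e ∉ I) (hsub : ∀ f ∈ I', f ≠ e → f ∈ I) : False := by
  classical
  have h1 : ∃ x ∈ e.val, x ∉ S := by
    by_contra h
    push Not at h
    exact he ((hI e).2 h)
  obtain ⟨x, hx, hxS⟩ := h1
  have hxS' : x ∈ S' := (hI' e).1 he' x hx
  obtain ⟨y, hy⟩ := hx
  have : ∃ z ∈ S', z ∉ ({x, y} : Finset (Fin n)) := by
    apply Finset.exists_mem_notMem_of_card_lt_card
    exact lt_of_le_of_lt Finset.card_le_two (by omega)
  obtain ⟨z, hz, hzn⟩ := this
  simp only [Finset.mem_insert, Finset.mem_singleton, not_or] at hzn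
  have hnd : ¬ (s(x, z)).IsDiag := by
    simpa using Ne.symm hzn.1
  have hin : (⟨s(x, z), hnd⟩ : Edge n) ∈ I' := by
    rw [hI']
    simp [hxS', hz]
  have hne : (⟨s(x, z), hnd⟩ : Edge n) ≠ e := by
    intro h
    have h2 : s(x, z) = e.val := congrArg Subtype.val h
    rw [hy] at h2
    simp only [Sym2.eq_iff] at h2
    rcases h2 with h2 | h2
    · exact hzn.2 h2.2
    · exact hzn.1 h2.2
  have := (hI _).1 (hsub _ hin hne) x (by simp)
  exact hxS this

lemma exists_col_basis {m ι : Type*} [Fintype m] [Fintype ι] (E : Matrix m ι ℂ)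
    {s t : Set ι} (hst : s ⊆ t) (hs : LinearIndepOn ℂ E.col s)
    (ht : ∀ e, E.col e ∈ Submodule.span ℂ (E.col '' t)) :
    ∃ I : Finset ι, (I : Set ι) ⊆ t ∧ s ⊆ I ∧ LinearIndependent ℂ (fun e : I => E.col e.1) ∧
      I.card = E.rank ∧ ∀ e, E.col e ∈ Submodule.span ℂ (E.col '' (I : Set ι)) := by
  classical
  obtain ⟨b, hbt, hsb, hspan, hli⟩ := exists_linearIndepOn_extension hs hst
  obtain ⟨I, rfl⟩ : ∃ I : Finset ι, (I : Set ι) = b := ⟨b.toFinset, by simp⟩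
  have hsp : ∀ e, E.col e ∈ Submodule.span ℂ (E.col '' (I : Set ι)) := fun e =>
    (Submodule.span_le.mpr hspan) (ht e)
  refine ⟨I, hbt, hsb, hli, ?_, hsp⟩
  have hli' : LinearIndependent ℂ (fun e : I => E.col e.1) := hli
  have h1 := finrank_span_eq_card hli'
  rw [Fintype.card_coe] at h1
  have heq : Submodule.span ℂ (Set.range fun e : I => E.col e.1) =
      Submodule.span ℂ (Set.range E.col) := by
    apply le_antisymm
    · apply Submodule.span_mono
      rintro _ ⟨e, rfl⟩
      exact ⟨e.1, rfl⟩
    · rw [Submodule.span_le]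
      rintro _ ⟨e, rfl⟩
      have := hsp e
      rwa [Set.image_eq_range] at this
  rw [Matrix.rank_eq_finrank_span_cols, ← h1, heq]

end FinalPart

/-- Let `d ≥ 1`, `n ≥ d+2` and `D = C(d+2,2)`.  Let `E` be a
`D × N` complex matrix of rank `r` (rows indexed by `Fin D`, columns by the
edges of `K_n`).  If the image `E(L_{d,n})` does not have dimension `r`, then
`r = D` and `E` has `K_{d+2}` support: all columns of `E` vanish except possibly
those indexing the edges of a single complete subgraph `K_{d+2}` of `K_n`. -/
theorem rank_dropping_linear_map_has_Kd2_support
    {d n : ℕ} (hd : 1 ≤ d) (hn : d + 2 ≤ n)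
    (E : Matrix (Fin ((d + 2).choose 2)) (Edge n) ℂ) (r : ℕ)
    (hr : E.rank = r)
    (hdim : setDim ((fun x => E.mulVec x) '' Lvar d n) ≠ (r : WithBot ℕ∞)) :
    r = (d + 2).choose 2 ∧
    ∃ S : Finset (Fin n), S.card = d + 2 ∧
      ∀ e : Edge n, ¬ (∀ a ∈ (e : Sym2 (Fin n)), a ∈ S) → ∀ i, E i e = 0 := by
  classical
  obtain ⟨I, -, -, hli, hcard, hsp⟩ := exists_col_basis E (Set.subset_univ (∅ : Set (Edge n)))
    (linearIndepOn_empty ℂ _) (fun e => Submodule.subset_span ⟨e, trivial, rfl⟩)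
  have hIr : I.card = r := hcard.trans hr
  obtain ⟨hD, S, hS, hI⟩ := basis_is_K hd E I hli hcard (by rw [hIr]; exact hdim)
  refine ⟨hIr.symm.trans hD, S, hS, ?_⟩
  intro e he i
  by_contra hne
  have heI : e ∉ I := fun h => he ((hI e).1 h)
  have hcol : E.col e ≠ 0 := fun h => hne (congrFun h i)
  obtain ⟨I', hI't, heI', hli', hcard', -⟩ := exists_col_basis E
    (s := {e}) (t := insert e (I : Set (Edge n))) (by simp)
    (LinearIndepOn.singleton hcol)
    (fun f => Submodule.span_mono (Set.image_mono (Set.subset_insert _ _)) (hsp f))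
  obtain ⟨-, S', hS', hI'⟩ := basis_is_K hd E I' hli' hcard' (by rw [hcard', hr]; exact hdim)
  refine two_K hd hS' hI hI' (heI' rfl) heI ?_
  intro f hf hfe
  rcases hI't hf with h | h
  · exact absurd h hfe
  · exact h
end
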